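/- Let n ≥ 1, 0 ≤ δ < 1 and a ∈ S^{-n}_{0,δ}. Then there is a constant C such that for every Schwartz function f and every x ∈ ℝⁿ, M^♯(T_a f)(x) ≤ C M f(x). -/

import Mathlib

open MeasureTheory Real
open scoped ENNReal NNReal InnerProductSpace BigOperators

noncomputable section

/-- `ℝⁿ` with its Euclidean structure. -/
abbrev Rn (n : ℕ) : Type := EuclideanSpace ℝ (Fin n)

/-- The Fourier transform `û(ξ) = ∫ e^{-i⟨x,ξ⟩} u(x) dx`. -/
def ft {n : ℕ} (u : Rn n → ℂ) (ξ : Rn n) : ℂ :=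
  ∫ x : Rn n, Complex.exp (-(Complex.I * ((⟪x, ξ⟫_ℝ : ℝ) : ℂ))) * u x

/-- The pseudo-differential operator `T_a u(x) = ∫ e^{i⟨x,ξ⟩} a(x,ξ) û(ξ) dξ`. -/
def pdo {n : ℕ} (a : Rn n → Rn n → ℂ) (u : Rn n → ℂ) (x : Rn n) : ℂ :=
  ∫ ξ : Rn n, Complex.exp (Complex.I * ((⟪x, ξ⟫_ℝ : ℝ) : ℂ)) * a x ξ * ft u ξ

/-- The dual operator `T_a^* u(x) = ∫∫ e^{i⟨x-y,ξ⟩} a(y,ξ) dξ u(y) dy`. -/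
def pdoDual {n : ℕ} (a : Rn n → Rn n → ℂ) (u : Rn n → ℂ) (x : Rn n) : ℂ :=
  ∫ y : Rn n,
    (∫ ξ : Rn n, Complex.exp (Complex.I * ((⟪x - y, ξ⟫_ℝ : ℝ) : ℂ)) * a y ξ) * u y

/-- The Hörmander symbol class `S^m_{ϱ,δ}`: `a` is smooth and
`|∂^β_x ∂^α_ξ a(x,ξ)| ≤ C_{α,β} (1+|ξ|²)^{(m-ϱ|α|+δ|β|)/2}`. -/
def HormClass {n : ℕ} (m ϱ δ : ℝ) (a : Rn n → Rn n → ℂ) : Prop :=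
  ContDiff ℝ (⊤ : ℕ∞) (Function.uncurry a) ∧
  ∀ k l : ℕ, ∃ C : ℝ, 0 < C ∧ ∀ x ξ : Rn n,
    ‖iteratedFDeriv ℝ l (fun y : Rn n => iteratedFDeriv ℝ k (fun η : Rn n => a y η) ξ) x‖ ≤
      C * (1 + ‖ξ‖ ^ 2) ^ ((m - ϱ * k + δ * l) / 2)

/-- The rough Hörmander class `L^∞S^m_ϱ`: `a(x,ξ)` is smooth in `ξ`, bounded measurable in `x`,
and `‖∂^α_ξ a(·,ξ)‖_{L^∞} ≤ C_α (1+|ξ|²)^{(m-ϱ|α|)/2}`. -/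
def RoughClass {n : ℕ} (m ϱ : ℝ) (a : Rn n → Rn n → ℂ) : Prop :=
  (∀ x : Rn n, ContDiff ℝ (⊤ : ℕ∞) (a x)) ∧
  (∀ ξ : Rn n, Measurable fun x : Rn n => a x ξ) ∧
  ∀ k : ℕ, ∃ C : ℝ, 0 < C ∧ ∀ ξ : Rn n, ∀ᵐ x : Rn n ∂volume,
    ‖iteratedFDeriv ℝ k (a x) ξ‖ ≤ C * (1 + ‖ξ‖ ^ 2) ^ ((m - ϱ * k) / 2)

/-- The axis-parallel cube centered at `x₀` with side length `l`. -/
def cube {n : ℕ} (x₀ : Rn n) (l : ℝ) : Set (Rn n) :=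
  {y | ∀ i, |y i - x₀ i| ≤ l / 2}

/-- The Hardy–Littlewood maximal function over axis-parallel cubes. -/
def mHL {n : ℕ} {E : Type*} [NormedAddCommGroup E] (u : Rn n → E) (x : Rn n) : ℝ≥0∞ :=
  ⨆ (x₀ : Rn n) (l : ℝ) (_ : 0 < l) (_ : x ∈ cube x₀ l),
    (∫⁻ y in cube x₀ l, (‖u y‖₊ : ℝ≥0∞)) / ENNReal.ofReal (l ^ n)

/-- The Fefferman–Stein sharp maximal function over axis-parallel cubes. -/
def mSharp {n : ℕ} (u : Rn n → ℂ) (x : Rn n) : ℝ≥0∞ :=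
  ⨆ (x₀ : Rn n) (l : ℝ) (_ : 0 < l) (_ : x ∈ cube x₀ l),
    ⨅ c : ℂ, (∫⁻ y in cube x₀ l, (‖u y - c‖₊ : ℝ≥0∞)) / ENNReal.ofReal (l ^ n)

/-- The Muckenhoupt `A₁` condition: `Mω ≤ C ω` a.e. -/
def IsA1 {n : ℕ} (ω : Rn n → ℝ) : Prop :=
  (∀ x, 0 ≤ ω x) ∧ LocallyIntegrable ω volume ∧
  ∃ C : ℝ, 0 < C ∧ ∀ᵐ x : Rn n ∂volume, mHL ω x ≤ ENNReal.ofReal (C * ω x)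

/-- The Muckenhoupt `A_p` condition for `1 < p < ∞`. -/
def IsAp {n : ℕ} (p : ℝ) (ω : Rn n → ℝ) : Prop :=
  (∀ x, 0 ≤ ω x) ∧ LocallyIntegrable ω volume ∧
  ∃ C : ℝ, 0 < C ∧ ∀ (x₀ : Rn n) (l : ℝ), 0 < l →
    ((∫⁻ y in cube x₀ l, ENNReal.ofReal (ω y)) / ENNReal.ofReal (l ^ n)) *
      (((∫⁻ y in cube x₀ l, ENNReal.ofReal (ω y ^ (1 / (1 - p)))) /
          ENNReal.ofReal (l ^ n)) ^ (p - 1))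
      ≤ ENNReal.ofReal C

/-- The weighted measure `ω(s) = ∫_s ω dx`. -/
def wMeas {n : ℕ} (ω : Rn n → ℝ) (s : Set (Rn n)) : ℝ≥0∞ :=
  ∫⁻ x in s, ENNReal.ofReal (ω x)

/-- The weighted `L¹` norm `∫ |u| ω dx`. -/
def wL1 {n : ℕ} (ω : Rn n → ℝ) (u : Rn n → ℂ) : ℝ≥0∞ :=
  ∫⁻ x : Rn n, (‖u x‖₊ : ℝ≥0∞) * ENNReal.ofReal (ω x)

/-- The weighted `L^p` norm `(∫ |u|^p ω dx)^{1/p}`. -/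
def wLp {n : ℕ} (p : ℝ) (ω : Rn n → ℝ) (u : Rn n → ℂ) : ℝ≥0∞ :=
  (∫⁻ x : Rn n, (‖u x‖₊ : ℝ≥0∞) ^ p * ENNReal.ofReal (ω x)) ^ (1 / p)

/-- A Littlewood–Paley cut-off: `ψ ∈ C_c^∞`, `0 ≤ ψ ≤ 1`, supported in the annulus
`{C₀⁻¹ ≤ |ξ| ≤ 2C₀}`. -/
def LPcut {n : ℕ} (C₀ : ℝ) (ψ : Rn n → ℝ) : Prop :=
  ContDiff ℝ (⊤ : ℕ∞) ψ ∧ HasCompactSupport ψ ∧ (∀ ξ, 0 ≤ ψ ξ) ∧ (∀ ξ, ψ ξ ≤ 1) ∧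
  tsupport ψ ⊆ {ξ : Rn n | C₀⁻¹ ≤ ‖ξ‖ ∧ ‖ξ‖ ≤ 2 * C₀}

/-- `K_j(x,y) = (2π)^{-n} ∫ e^{i⟨x-y,ξ⟩} a(x,ξ) ψ(2^{-j}ξ) dξ`. -/
def Kj {n : ℕ} (a : Rn n → Rn n → ℂ) (ψ : Rn n → ℝ) (j : ℕ) (x y : Rn n) : ℂ :=
  ((((2 * π) ^ n)⁻¹ : ℝ) : ℂ) *
    ∫ ξ : Rn n, Complex.exp (Complex.I * ((⟪x - y, ξ⟫_ℝ : ℝ) : ℂ)) * a x ξ *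
      ((ψ ((((2 : ℝ) ^ j)⁻¹) • ξ) : ℝ) : ℂ)

/-- `K_j^*(x,y) = (2π)^{-n} ∫ e^{i⟨x-y,ξ⟩} a(y,ξ) ψ(2^{-j}ξ) dξ`. -/
def KjStar {n : ℕ} (a : Rn n → Rn n → ℂ) (ψ : Rn n → ℝ) (j : ℕ) (x y : Rn n) : ℂ :=
  ((((2 * π) ^ n)⁻¹ : ℝ) : ℂ) *
    ∫ ξ : Rn n, Complex.exp (Complex.I * ((⟪x - y, ξ⟫_ℝ : ℝ) : ℂ)) * a y ξ *
      ((ψ ((((2 : ℝ) ^ j)⁻¹) • ξ) : ℝ) : ℂ)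

/-- `T_j u(x) = ∫ K_j(x,y) u(y) dy`. -/
def Tj {n : ℕ} (a : Rn n → Rn n → ℂ) (ψ : Rn n → ℝ) (j : ℕ) (u : Rn n → ℂ) (x : Rn n) : ℂ :=
  ∫ y : Rn n, Kj a ψ j x y * u y

/-- `T_j^* u(x) = ∫ K_j^*(x,y) u(y) dy`. -/
def TjStar {n : ℕ} (a : Rn n → Rn n → ℂ) (ψ : Rn n → ℝ) (j : ℕ) (u : Rn n → ℂ) (x : Rn n) : ℂ :=
  ∫ y : Rn n, KjStar a ψ j x y * u y

/-- The Fourier integral operator `T_{a,φ} u(x) = ∫ e^{iφ(x,ξ)} a(x,ξ) û(ξ) dξ`. -/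
def fio {n : ℕ} (a : Rn n → Rn n → ℂ) (φ : Rn n → Rn n → ℝ) (u : Rn n → ℂ) (x : Rn n) : ℂ :=
  ∫ ξ : Rn n, Complex.exp (Complex.I * ((φ x ξ : ℝ) : ℂ)) * a x ξ * ft u ξ

/-- The dual FIO `T^*_{a,φ} u(x) = ∫∫ e^{i(φ(y,ξ)-⟨x,ξ⟩)} a(y,ξ) dξ u(y) dy`. -/
def fioDual {n : ℕ} (a : Rn n → Rn n → ℂ) (φ : Rn n → Rn n → ℝ) (u : Rn n → ℂ) (x : Rn n) : ℂ :=
  ∫ y : Rn n,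
    (∫ ξ : Rn n, Complex.exp (Complex.I * ((φ y ξ - ⟪x, ξ⟫_ℝ : ℝ) : ℂ)) * a y ξ) * u y

/-- The phase class `Φ¹`: smooth on `ℝⁿ × (ℝⁿ∖{0})`, positively homogeneous of degree 1 in `ξ`,
with `sup |ξ|^{-1+|α|} |∂^α_ξ ∂^β_x φ| ≤ C_{α,β}` for `|α|+|β| ≥ 1`. -/
def Phi1 {n : ℕ} (φ : Rn n → Rn n → ℝ) : Prop :=
  ContDiffOn ℝ (⊤ : ℕ∞) (Function.uncurry φ) {p : Rn n × Rn n | p.2 ≠ 0} ∧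
  (∀ x : Rn n, ∀ ξ : Rn n, ξ ≠ 0 → ∀ t : ℝ, 0 < t → φ x (t • ξ) = t * φ x ξ) ∧
  ∀ k l : ℕ, 1 ≤ k + l → ∃ C : ℝ, 0 < C ∧ ∀ x ξ : Rn n, ξ ≠ 0 →
    ‖ξ‖ ^ ((k : ℝ) - 1) *
        ‖iteratedFDeriv ℝ k (fun η : Rn n => iteratedFDeriv ℝ l (fun y : Rn n => φ y η) x) ξ‖
      ≤ C

/-- The rough phase class `L^∞Φ¹`: positively homogeneous of degree 1 in `ξ`, smooth in `ξ` away
from the origin, bounded measurable in `x`, with `sup |ξ|^{-1+|α|} ‖∂^α_ξ φ(·,ξ)‖_{L^∞} ≤ C_α`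
for `|α| ≥ 1`. -/
def LinfPhi1 {n : ℕ} (φ : Rn n → Rn n → ℝ) : Prop :=
  (∀ x : Rn n, ContDiffOn ℝ (⊤ : ℕ∞) (φ x) {ξ : Rn n | ξ ≠ 0}) ∧
  (∀ ξ : Rn n, Measurable fun x : Rn n => φ x ξ) ∧
  (∀ ξ : Rn n, ∃ C : ℝ, ∀ x : Rn n, |φ x ξ| ≤ C) ∧
  (∀ x : Rn n, ∀ ξ : Rn n, ξ ≠ 0 → ∀ t : ℝ, 0 < t → φ x (t • ξ) = t * φ x ξ) ∧
  ∀ k : ℕ, 1 ≤ k → ∃ C : ℝ, 0 < C ∧ ∀ ξ : Rn n, ξ ≠ 0 → ∀ᵐ x : Rn n ∂volume,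
    ‖ξ‖ ^ ((k : ℝ) - 1) * ‖iteratedFDeriv ℝ k (φ x) ξ‖ ≤ C

theorem isClosed_cube {n : ℕ} (z : Rn n) (l : ℝ) : IsClosed (cube z l) := by
  have : cube z l = ⋂ i, {y : Rn n | |y i - z i| ≤ l / 2} := by
    ext y; simp [cube]
  rw [this]
  refine isClosed_iInter fun i => isClosed_le ?_ continuous_const
  fun_prop

theorem measurableSet_cube {n : ℕ} (z : Rn n) (l : ℝ) : MeasurableSet (cube z l) :=
  (isClosed_cube z l).measurableSet

theorem volume_cube {n : ℕ} (z : Rn n) {l : ℝ} (hl : 0 ≤ l) :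
    volume (cube z l) = ENNReal.ofReal (l ^ n) := by
  have h := (EuclideanSpace.volume_preserving_symm_measurableEquiv_toLp (Fin n)).measure_preimage
    (s := Set.univ.pi fun i => Metric.closedBall (z i) (l / 2))
    (MeasurableSet.univ_pi fun i => measurableSet_closedBall).nullMeasurableSet
  have h2 : cube z l = (MeasurableEquiv.toLp 2 (Fin n → ℝ)).symm ⁻¹'
      (Set.univ.pi fun i => Metric.closedBall (z i) (l / 2)) := by
    ext y
    simp [cube, Real.dist_eq]
  rw [h2, h, volume_pi_pi]
  simp only [Real.volume_closedBall, Finset.prod_const, Finset.card_univ, Fintype.card_fin]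
  rw [← ENNReal.ofReal_pow (by positivity)]
  congr 2; ring

theorem mem_cube_symm {n : ℕ} {x z : Rn n} {l : ℝ} : x ∈ cube z l ↔ z ∈ cube x l := by
  simp only [cube, Set.mem_ofPred_eq]
  exact forall_congr' fun i => by rw [abs_sub_comm]

theorem mem_cube_of_norm_le {n : ℕ} {x z : Rn n} {r : ℝ} (h : ‖z - x‖ ≤ r) :
    x ∈ cube z (2 * r) := by
  intro i
  have := PiLp.norm_apply_le (p := 2) (z - x) i
  rw [Real.norm_eq_abs, PiLp.sub_apply, abs_sub_comm] at this
  linarith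

theorem mem_cube_add {n : ℕ} {x y z : Rn n} {l r : ℝ} (h : x ∈ cube y l) (h' : y ∈ cube z r) :
    x ∈ cube z (r + l) := by
  intro i
  have := abs_sub_le (x i) (y i) (z i)
  have h1 := h i
  have h2 := h' i
  linarith

theorem cube_subset_cube {n : ℕ} {z : Rn n} {l r : ℝ} (h : l ≤ r) : cube z l ⊆ cube z r :=
  fun _ hy i => (hy i).trans (by linarith)

theorem norm_sub_le_of_mem_cube {n : ℕ} {x z : Rn n} {l : ℝ} (h : x ∈ cube z l) :
    ‖x - z‖ ≤ n * l := by
  have h1 : ‖x - z‖ ≤ ∑ i, ‖(x - z) i‖ := by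
    conv_lhs => rw [← (EuclideanSpace.basisFun (Fin n) ℝ).sum_repr (x - z)]
    refine (norm_sum_le _ _).trans (le_of_eq ?_)
    simp [norm_smul]
  refine h1.trans ?_
  have h2 : ∀ i ∈ Finset.univ, ‖(x - z) i‖ ≤ l := fun i _ => by
    have := h i
    have h0 := abs_nonneg (x i - z i)
    rw [PiLp.sub_apply, Real.norm_eq_abs]
    linarith
  simpa using Finset.sum_le_card_nsmul _ _ _ h2

theorem lintegral_cube_le_mHL {n : ℕ} (u : Rn n → ℂ) {x z : Rn n} {l : ℝ} (hl : 0 < l)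
    (hx : x ∈ cube z l) :
    ∫⁻ y in cube z l, ‖u y‖ₑ ≤ ENNReal.ofReal (l ^ n) * mHL u x := by
  have h : (∫⁻ y in cube z l, ‖u y‖ₑ) / ENNReal.ofReal (l ^ n) ≤ mHL u x :=
    le_iSup_of_le z <| le_iSup_of_le l <| le_iSup_of_le hl <| le_iSup_of_le hx le_rfl
  rw [mul_comm]
  refine (ENNReal.div_le_iff ?_ ENNReal.ofReal_ne_top).1 h
  simpa using pow_pos hl n

theorem inv_pow_weight_le_tsum {n : ℕ} (M : ℕ) (z y : Rn n) :
    ENNReal.ofReal (((1 + ‖z - y‖) ^ M)⁻¹) ≤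
      ∑' k : ℕ, ENNReal.ofReal ((((k : ℝ) + 1) ^ M)⁻¹) *
        (cube z (2 * (k + 1))).indicator 1 y := by
  refine le_trans ?_ (ENNReal.le_tsum ⌊‖z - y‖⌋₊)
  have h1 : ‖z - y‖ ≤ (⌊‖z - y‖⌋₊ : ℝ) + 1 := (Nat.lt_floor_add_one _).le
  have h2 : (⌊‖z - y‖⌋₊ : ℝ) ≤ ‖z - y‖ := Nat.floor_le (norm_nonneg _)
  rw [Set.indicator_of_mem (mem_cube_of_norm_le h1), Pi.one_apply, mul_one]
  refine ENNReal.ofReal_le_ofReal ?_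
  exact inv_anti₀ (by positivity) (pow_le_pow_left₀ (by positivity) (by linarith) _)

theorem lintegral_weight_le_tsum {n : ℕ} (M : ℕ) {g : Rn n → ℝ≥0∞} (hg : Measurable g)
    (z : Rn n) :
    ∫⁻ y, g y * ENNReal.ofReal (((1 + ‖z - y‖) ^ M)⁻¹) ≤
      ∑' k : ℕ, ENNReal.ofReal ((((k : ℝ) + 1) ^ M)⁻¹) *
        ∫⁻ y in cube z (2 * (k + 1)), g y := by
  calc _ ≤ ∫⁻ y, ∑' k : ℕ, ENNReal.ofReal ((((k : ℝ) + 1) ^ M)⁻¹) *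
        (cube z (2 * (k + 1))).indicator g y := by
        refine lintegral_mono fun y => ?_
        refine (mul_le_mul_right (inv_pow_weight_le_tsum M z y) _).trans (le_of_eq ?_)
        rw [← ENNReal.tsum_mul_left]
        refine tsum_congr fun k => ?_
        by_cases h : y ∈ cube z (2 * ((k : ℝ) + 1))
        · rw [Set.indicator_of_mem h, Set.indicator_of_mem h, Pi.one_apply, mul_one, mul_comm]
        · rw [Set.indicator_of_notMem h, Set.indicator_of_notMem h, mul_zero, mul_zero]
    _ = _ := by
        rw [lintegral_tsum]
        · refine tsum_congr fun k => ?_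
          rw [lintegral_const_mul _ (hg.indicator (measurableSet_cube _ _)),
            lintegral_indicator (measurableSet_cube _ _)]
        · exact fun k => ((hg.indicator (measurableSet_cube _ _)).const_mul _).aemeasurable

/-- The sum `∑ (k+1)⁻²`. -/
def sumInvSq : ℝ := ∑' k : ℕ, (((k : ℝ) + 1) ^ 2)⁻¹

theorem summable_inv_sq : Summable fun k : ℕ => (((k : ℝ) + 1) ^ 2)⁻¹ := by
  have h := (summable_nat_add_iff 1).2 (Real.summable_nat_pow_inv.2 (one_lt_two : 1 < 2))
  simpa using h

theorem tsum_ofReal_inv_sq_mul (c : ℝ≥0∞) :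
    ∑' k : ℕ, ENNReal.ofReal ((((k : ℝ) + 1) ^ 2)⁻¹) * c = ENNReal.ofReal sumInvSq * c := by
  rw [ENNReal.tsum_mul_right, sumInvSq,
    ENNReal.ofReal_tsum_of_nonneg (fun k => by positivity) summable_inv_sq]

theorem lintegral_weight_le_mHL {n : ℕ} {u : Rn n → ℂ} (hu : Measurable u) {x z : Rn n} {l : ℝ}
    (hl : l ≤ 1) (hx : x ∈ cube z l) :
    ∫⁻ y, ‖u y‖ₑ * ENNReal.ofReal (((1 + ‖z - y‖) ^ (2 * n + 2))⁻¹) ≤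
      ENNReal.ofReal (2 ^ n * sumInvSq) * mHL u x := by
  refine (lintegral_weight_le_tsum _ hu.enorm z).trans ?_
  have key : ∀ k : ℕ, ENNReal.ofReal ((((k : ℝ) + 1) ^ (2 * n + 2))⁻¹) *
        ∫⁻ y in cube z (2 * (k + 1)), ‖u y‖ₑ ≤
      ENNReal.ofReal ((((k : ℝ) + 1) ^ 2)⁻¹) * (ENNReal.ofReal (2 ^ n) * mHL u x) := by
    intro k
    have hk : (0 : ℝ) < k + 1 := by positivity
    have hk1 : (1 : ℝ) ≤ k + 1 := by simp
    refine (mul_le_mul_right (lintegral_cube_le_mHL u (x := x) (by positivity)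
      (cube_subset_cube (by linarith) hx)) _).trans ?_
    rw [← mul_assoc, ← mul_assoc, ← ENNReal.ofReal_mul (by positivity),
      ← ENNReal.ofReal_mul (by positivity)]
    refine mul_le_mul_left (ENNReal.ofReal_le_ofReal ?_) _
    rw [mul_pow, show 2 * n + 2 = 2 + n + n by ring, pow_add, pow_add]
    have : (1 : ℝ) ≤ ((k : ℝ) + 1) ^ n := one_le_pow₀ hk1
    rw [inv_mul_le_iff₀ (by positivity)]
    field_simp
    exact this
  refine (ENNReal.tsum_le_tsum key).trans (le_of_eq ?_)
  rw [tsum_ofReal_inv_sq_mul, ← mul_assoc, ← ENNReal.ofReal_mul (by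
    exact tsum_nonneg fun k => by positivity), mul_comm sumInvSq]

theorem lintegral_cube_lintegral_weight_le_mHL {n : ℕ} {u : Rn n → ℂ} (hu : Measurable u)
    {x z : Rn n} {l : ℝ} (hl : 1 ≤ l) (hx : x ∈ cube z l) :
    ∫⁻ w in cube z (l + 1), ∫⁻ y, ‖u y‖ₑ * ENNReal.ofReal (((1 + ‖w - y‖) ^ (2 * n + 2))⁻¹) ≤
      ENNReal.ofReal (l ^ n) * (ENNReal.ofReal (8 ^ n * sumInvSq) * mHL u x) := by
  refine (lintegral_mono fun w => lintegral_weight_le_tsum _ hu.enorm w).trans ?_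
  have hmeas : ∀ k : ℕ, MeasurableSet {p : Rn n × Rn n | p.2 ∈ cube p.1 (2 * ((k : ℝ) + 1))} := by
    intro k
    have : {p : Rn n × Rn n | p.2 ∈ cube p.1 (2 * ((k : ℝ) + 1))} =
        ⋂ i, {p : Rn n × Rn n | |p.2 i - p.1 i| ≤ (2 * ((k : ℝ) + 1)) / 2} := by
      ext y; simp [cube]
    rw [this]
    exact (isClosed_iInter fun i => isClosed_le (by fun_prop) continuous_const).measurableSet
  have hm2 : ∀ k : ℕ, Measurable fun p : Rn n × Rn n =>
      (cube p.1 (2 * ((k : ℝ) + 1))).indicator (fun y => ‖u y‖ₑ) p.2 := fun k =>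
    (hu.enorm.comp measurable_snd).indicator (hmeas k)
  have heq : ∀ (k : ℕ) (w : Rn n), ∫⁻ y in cube w (2 * (k + 1)), ‖u y‖ₑ =
      ∫⁻ y, (cube w (2 * ((k : ℝ) + 1))).indicator (fun y => ‖u y‖ₑ) y := fun k w =>
    (lintegral_indicator (measurableSet_cube _ _) _).symm
  simp_rw [heq]
  have hm3 : ∀ k : ℕ, Measurable fun w : Rn n =>
      ∫⁻ y, (cube w (2 * ((k : ℝ) + 1))).indicator (fun y => ‖u y‖ₑ) y := fun k =>
    (hm2 k).lintegral_prod_right'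
  rw [lintegral_tsum fun k => ((hm3 k).const_mul _).aemeasurable]
  have key : ∀ k : ℕ, ENNReal.ofReal ((((k : ℝ) + 1) ^ (2 * n + 2))⁻¹) *
        ∫⁻ w in cube z (l + 1), ∫⁻ y, (cube w (2 * ((k : ℝ) + 1))).indicator (fun y => ‖u y‖ₑ) y ≤
      ENNReal.ofReal ((((k : ℝ) + 1) ^ 2)⁻¹) *
        (ENNReal.ofReal (8 ^ n) * ENNReal.ofReal (l ^ n) * mHL u x) := by
    intro k
    have hk : (0 : ℝ) < k + 1 := by positivity
    have hk1 : (1 : ℝ) ≤ k + 1 := by simp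
    have h1 : ∫⁻ w in cube z (l + 1), ∫⁻ y,
        (cube w (2 * ((k : ℝ) + 1))).indicator (fun y => ‖u y‖ₑ) y ≤
        ENNReal.ofReal ((2 * ((k : ℝ) + 1)) ^ n) *
          ∫⁻ y in cube z (l + 1 + 2 * (k + 1)), ‖u y‖ₑ := by
      rw [lintegral_lintegral_swap (hm2 k).aemeasurable,
        ← lintegral_const_mul _ hu.enorm, ← lintegral_indicator (measurableSet_cube _ _)]
      refine lintegral_mono fun y => ?_
      by_cases hy : y ∈ cube z (l + 1 + 2 * ((k : ℝ) + 1))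
      · rw [Set.indicator_of_mem hy]
        have : ∀ w, (cube w (2 * ((k : ℝ) + 1))).indicator (fun y => ‖u y‖ₑ) y =
            (cube y (2 * ((k : ℝ) + 1))).indicator (fun _ => ‖u y‖ₑ) w := fun w => by
          by_cases h : y ∈ cube w (2 * ((k : ℝ) + 1))
          · rw [Set.indicator_of_mem h, Set.indicator_of_mem (mem_cube_symm.1 h)]
          · rw [Set.indicator_of_notMem h, Set.indicator_of_notMem (mt mem_cube_symm.1 h)]
        simp_rw [this]
        refine (lintegral_mono' Measure.restrict_le_self le_rfl).trans ?_
        rw [lintegral_indicator_const (measurableSet_cube _ _), volume_cube _ (by positivity),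
          mul_comm]
      · rw [Set.indicator_of_notMem hy, nonpos_iff_eq_zero,
          setLIntegral_eq_zero (measurableSet_cube _ _)]
        intro w hw
        exact Set.indicator_of_notMem (fun h => hy (mem_cube_add h hw)) _
    refine (mul_le_mul_right (h1.trans (mul_le_mul_right (lintegral_cube_le_mHL u (x := x)
      (by positivity) (cube_subset_cube (by linarith) hx)) _)) _).trans ?_
    rw [← mul_assoc, ← mul_assoc, ← mul_assoc, ← ENNReal.ofReal_mul (by positivity),
      ← ENNReal.ofReal_mul (by positivity), ← ENNReal.ofReal_mul (by positivity),
      ← ENNReal.ofReal_mul (by positivity)]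
    refine mul_le_mul_left (ENNReal.ofReal_le_ofReal ?_) _
    have h4 : (l + 1 + 2 * ((k : ℝ) + 1)) ^ n ≤ (4 * l * (k + 1)) ^ n := by
      gcongr
      nlinarith
    have h8 : (8 : ℝ) ^ n = 2 ^ n * 4 ^ n := by rw [← mul_pow]; norm_num
    calc _ ≤ (((k : ℝ) + 1) ^ (2 * n + 2))⁻¹ * (2 * ((k : ℝ) + 1)) ^ n * (4 * l * (k + 1)) ^ n := by
          gcongr
      _ = _ := by
          rw [mul_pow, mul_pow, mul_pow, show 2 * n + 2 = 2 + n + n by ring, pow_add, pow_add, h8]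
          field_simp
  refine (ENNReal.tsum_le_tsum fun k =>
    (lintegral_const_mul _ (hm3 k)).trans_le (key k)).trans (le_of_eq ?_)
  rw [tsum_ofReal_inv_sq_mul, ENNReal.ofReal_mul (p := 8 ^ n) (by positivity)]
  ring

theorem lintegral_cube_le_lintegral_lintegral_unit_cube {n : ℕ} {g : Rn n → ℝ≥0∞}
    (hg : Measurable g) (z : Rn n) (l : ℝ) :
    ∫⁻ x in cube z l, g x ≤ ∫⁻ w in cube z (l + 1), ∫⁻ x in cube w 1, g x := by
  have hmeas : MeasurableSet {p : Rn n × Rn n | p.2 ∈ cube p.1 1} := by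
    have : {p : Rn n × Rn n | p.2 ∈ cube p.1 1} =
        ⋂ i, {p : Rn n × Rn n | |p.2 i - p.1 i| ≤ 1 / 2} := by
      ext y; simp [cube]
    rw [this]
    exact (isClosed_iInter fun i => isClosed_le (by fun_prop) continuous_const).measurableSet
  have hm2 : Measurable fun p : Rn n × Rn n => (cube p.1 1).indicator g p.2 :=
    (hg.comp measurable_snd).indicator hmeas
  have heq : ∫⁻ w in cube z (l + 1), ∫⁻ x in cube w 1, g x =
      ∫⁻ w in cube z (l + 1), ∫⁻ x, (cube w 1).indicator g x :=
    lintegral_congr fun w => (lintegral_indicator (measurableSet_cube w 1) g).symm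
  rw [heq]
  rw [lintegral_lintegral_swap hm2.aemeasurable, ← lintegral_indicator (measurableSet_cube _ _)]
  refine lintegral_mono fun x => ?_
  by_cases hx : x ∈ cube z l
  · rw [Set.indicator_of_mem hx]
    calc g x = ∫⁻ w in cube x 1, g x := by
          rw [setLIntegral_const, volume_cube _ zero_le_one]; simp
      _ = ∫⁻ w in cube x 1, (cube w 1).indicator g x :=
          setLIntegral_congr_fun (measurableSet_cube _ _) fun w hw =>
            (Set.indicator_of_mem (mem_cube_symm.1 hw) g).symm
      _ ≤ _ := lintegral_mono_set fun w hw => mem_cube_add hw hx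
  · simp [hx]

theorem lintegral_smul_eq {n : ℕ} (f : Rn n → ℝ≥0∞) {r : ℝ} (hr : 0 < r) :
    ∫⁻ x, f (r • x) = ENNReal.ofReal ((r ^ n)⁻¹) * ∫⁻ x, f x := by
  have h := (measurableEmbedding_const_smul₀ (α := Rn n) hr.ne').lintegral_map
    (μ := volume) f
  rw [← h, Measure.map_addHaar_smul volume hr.ne', lintegral_smul_measure, finrank_euclideanSpace,
    Fintype.card_fin, abs_of_pos (by positivity), smul_eq_mul]

/-- The total mass of the weight `(1 + ‖x‖)⁻ʳ` on `ℝⁿ`. -/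
def weightMass (n : ℕ) (r : ℝ) : ℝ≥0∞ := ∫⁻ x : Rn n, ENNReal.ofReal ((1 + ‖x‖) ^ (-r))

theorem weightMass_lt_top {n : ℕ} {r : ℝ} (hr : (n : ℝ) < r) : weightMass n r < ∞ :=
  finite_integral_one_add_norm (by simpa using hr)

theorem lintegral_dilated_weight {n : ℕ} (ξ : Rn n) {s : ℝ} (hs : 0 < s) :
    ∫⁻ η : Rn n, ENNReal.ofReal (((1 + ‖ξ - η‖ / s) ^ (n + 1))⁻¹) =
      ENNReal.ofReal (s ^ n) * weightMass n (n + 1) := by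
  rw [lintegral_sub_left_eq_self (μ := (volume : Measure (Rn n)))
    (fun η => ENNReal.ofReal (((1 + ‖η‖ / s) ^ (n + 1))⁻¹)) ξ]
  have h := lintegral_smul_eq (fun x : Rn n => ENNReal.ofReal ((1 + ‖x‖) ^ (-((n : ℝ) + 1))))
    (inv_pos.2 hs)
  rw [weightMass]
  have h2 : (s⁻¹ ^ n)⁻¹ = s ^ n := by simp
  rw [h2] at h
  rw [← h]
  refine lintegral_congr fun x => ?_
  rw [norm_smul, Real.norm_of_nonneg (inv_pos.2 hs).le, rpow_neg (by positivity), ← div_eq_inv_mul]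
  congr 2
  exact_mod_cast (rpow_natCast _ _).symm

/-- The symmetrizable majorant of the `T T^*` kernel. -/
def schurMajorant {n : ℕ} (δ : ℝ) (ξ η : Rn n) : ℝ :=
  ((1 + ‖ξ‖) ^ (2 * n))⁻¹ * ((1 + ‖ξ - η‖ / (1 + ‖ξ‖) ^ δ) ^ (n + 1))⁻¹

theorem schurMajorant_nonneg {n : ℕ} (δ : ℝ) (ξ η : Rn n) : 0 ≤ schurMajorant δ ξ η := by
  unfold schurMajorant; positivity

theorem continuous_schurMajorant {n : ℕ} (δ : ℝ) :
    Continuous fun p : Rn n × Rn n => schurMajorant δ p.1 p.2 := by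
  have h1 : ∀ x : Rn n, 1 + ‖x‖ ≠ 0 := fun x => by positivity
  have h2 : ∀ x : Rn n, (1 + ‖x‖) ^ δ ≠ 0 := fun x => by positivity
  have h3 : Continuous fun p : Rn n × Rn n => (1 + ‖p.1‖) ^ δ :=
    Continuous.rpow_const (by fun_prop) fun p => Or.inl (h1 p.1)
  unfold schurMajorant
  refine Continuous.mul (Continuous.inv₀ (by fun_prop) fun p => by positivity)
    (Continuous.inv₀ (Continuous.pow (continuous_const.add
      (Continuous.div (by fun_prop) h3 fun p => h2 p.1)) _) fun p => by positivity)

theorem lintegral_schurMajorant_lt_top {n : ℕ} (hn : 1 ≤ n) {δ : ℝ} (hδ : δ < 1) :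
    ∫⁻ ξ : Rn n, ∫⁻ η : Rn n, ENNReal.ofReal (schurMajorant δ ξ η) < ∞ := by
  have h : ∀ ξ : Rn n, ∫⁻ η : Rn n, ENNReal.ofReal (schurMajorant δ ξ η) =
      weightMass n (n + 1) * ENNReal.ofReal ((1 + ‖ξ‖) ^ (-(2 * n - δ * n) : ℝ)) := by
    intro ξ
    have hp : 0 < 1 + ‖ξ‖ := by positivity
    unfold schurMajorant
    simp_rw [ENNReal.ofReal_mul (inv_nonneg.2 (pow_nonneg hp.le (2 * n)))]
    rw [lintegral_const_mul', lintegral_dilated_weight ξ (rpow_pos_of_pos hp δ), ← mul_assoc,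
      ← ENNReal.ofReal_mul (by positivity), mul_comm]
    · congr 2
      rw [← rpow_natCast, ← rpow_natCast, ← rpow_mul hp.le, ← rpow_neg hp.le, ← rpow_add hp]
      push_cast
      congr 1
      ring
    · exact ENNReal.ofReal_ne_top
  simp_rw [h]
  have hn' : (1 : ℝ) ≤ n := by exact_mod_cast hn
  rw [lintegral_const_mul' _ _ (weightMass_lt_top (by linarith)).ne]
  exact ENNReal.mul_lt_top (weightMass_lt_top (by linarith)) (weightMass_lt_top (by nlinarith))

theorem div_pow_le_of_le_add {n k : ℕ} {δ : ℝ} (hδ0 : 0 ≤ δ)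
    (hk : (n : ℝ) ≤ (1 - δ) * k) {σ τ d : ℝ} (hτ : 1 ≤ τ) (hτσ : τ ≤ σ) (hd : 0 ≤ d)
    (h : σ ≤ τ + d) : (σ / τ) ^ n ≤ (2 * (1 + d / σ ^ δ)) ^ k := by
  have hσ : 1 ≤ σ := hτ.trans hτσ
  have hσ0 : 0 < σ := by linarith
  have hτ0 : 0 < τ := by linarith
  have hs : 0 < σ ^ δ := rpow_pos_of_pos hσ0 δ
  have hu : 0 ≤ d / σ ^ δ := by positivity
  have hnk : n ≤ k := by
    have : (n : ℝ) ≤ k := hk.trans (by nlinarith [Nat.cast_nonneg (α := ℝ) k])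
    exact_mod_cast this
  rcases le_or_gt (σ / τ) 2 with h2 | h2
  · calc (σ / τ) ^ n ≤ 2 ^ n := by gcongr
      _ ≤ 2 ^ k := pow_le_pow_right₀ (by norm_num) hnk
      _ ≤ _ := by gcongr; linarith
  · rw [lt_div_iff₀ hτ0] at h2
    have h3 : σ ^ (1 - δ) ≤ 2 * (d / σ ^ δ) := by
      rw [rpow_sub hσ0, rpow_one, ← mul_div_assoc]
      gcongr
      linarith
    calc (σ / τ) ^ n ≤ σ ^ n := by
          gcongr
          exact div_le_self hσ0.le hτ
      _ = σ ^ (n : ℝ) := (rpow_natCast _ _).symm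
      _ ≤ σ ^ ((1 - δ) * k) := rpow_le_rpow_of_exponent_le hσ hk
      _ = (σ ^ (1 - δ)) ^ k := by rw [rpow_mul hσ0.le, rpow_natCast]
      _ ≤ (2 * (1 + d / σ ^ δ)) ^ k := by
          gcongr
          linarith

theorem weight_le_schurMajorant {n k : ℕ} {δ : ℝ} (hδ0 : 0 ≤ δ)
    (hk : (n : ℝ) ≤ (1 - δ) * k) {ξ η : Rn n} (h : ‖η‖ ≤ ‖ξ‖) :
    ((1 + ‖ξ‖) ^ n)⁻¹ * ((1 + ‖η‖) ^ n)⁻¹ *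
        ((1 + ‖ξ - η‖ / (1 + ‖ξ‖) ^ δ) ^ (n + 1 + k))⁻¹ ≤
      2 ^ k * schurMajorant δ ξ η := by
  have hd : 1 + ‖ξ‖ ≤ 1 + ‖η‖ + ‖ξ - η‖ := by
    have := norm_sub_norm_le ξ η
    linarith
  have key := div_pow_le_of_le_add hδ0 hk (by linarith [norm_nonneg η]) (by linarith)
    (norm_nonneg (ξ - η)) hd
  unfold schurMajorant
  set u := 1 + ‖ξ - η‖ / (1 + ‖ξ‖) ^ δ with hu
  have hu0 : 0 < u := by positivity
  have hσ : 0 < 1 + ‖ξ‖ := by positivity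
  have hτ : 0 < 1 + ‖η‖ := by positivity
  rw [div_pow, mul_pow, div_le_iff₀ (by positivity)] at key
  rw [pow_add u (n + 1), two_mul n, pow_add (1 + ‖ξ‖)]
  have : ((1 + ‖ξ‖) ^ n)⁻¹ * ((1 + ‖η‖) ^ n)⁻¹ * (u ^ (n + 1) * u ^ k)⁻¹ =
      (((1 + ‖ξ‖) ^ n)⁻¹ * ((1 + ‖ξ‖) ^ n)⁻¹ * (u ^ (n + 1))⁻¹) *
        ((1 + ‖ξ‖) ^ n / ((1 + ‖η‖) ^ n * u ^ k)) := by
    field_simp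
  rw [this, mul_inv, mul_comm (2 ^ k)]
  gcongr
  rw [div_le_iff₀ (by positivity)]
  linarith

theorem norm_iteratedFDeriv_mul_le_of_le {E : Type*} [NormedAddCommGroup E] [NormedSpace ℝ E]
    {f g : E → ℂ} {p : ℕ} {x : E} {F G R : ℝ} (hf : ContDiff ℝ p f) (hg : ContDiff ℝ p g)
    (hF : 0 ≤ F) (hR : 0 ≤ R)
    (hf' : ∀ i ≤ p, ‖iteratedFDeriv ℝ i f x‖ ≤ F * R ^ i)
    (hg' : ∀ i ≤ p, ‖iteratedFDeriv ℝ i g x‖ ≤ G * R ^ i) :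
    ‖iteratedFDeriv ℝ p (fun y => f y * g y) x‖ ≤ 2 ^ p * (F * G) * R ^ p := by
  refine (norm_iteratedFDeriv_mul_le hf hg x le_rfl).trans ?_
  have h : ∀ i ∈ Finset.range (p + 1), (p.choose i : ℝ) * ‖iteratedFDeriv ℝ i f x‖ *
      ‖iteratedFDeriv ℝ (p - i) g x‖ ≤ p.choose i * (F * G * R ^ p) := by
    intro i hi
    have hi : i ≤ p := Nat.lt_succ_iff.1 (Finset.mem_range.1 hi)
    calc _ ≤ (p.choose i : ℝ) * (F * R ^ i) * (G * R ^ (p - i)) := by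
          gcongr
          exacts [hf' i hi, hg' _ (Nat.sub_le _ _)]
      _ = _ := by
          rw [show R ^ p = R ^ i * R ^ (p - i) by rw [← pow_add, Nat.add_sub_cancel' hi]]
          ring
  refine (Finset.sum_le_sum h).trans (le_of_eq ?_)
  rw [← Finset.sum_mul, ← mul_assoc]
  congr 2
  exact_mod_cast Nat.sum_range_choose p

open scoped FourierTransform in
theorem pow_mul_norm_integral_exp_mul_le {n : ℕ} {G : Rn n → ℂ} (hG : ContDiff ℝ (⊤ : ℕ∞) G)
    (hGc : HasCompactSupport G) (N : ℕ) (w : Rn n) :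
    ‖w‖ ^ N * ‖∫ x, Complex.exp (Complex.I * ((⟪x, w⟫_ℝ : ℝ) : ℂ)) * G x‖ ≤
      (4 * π) ^ N * ∑ p ∈ Finset.range (N + 1), ∫ x, ‖iteratedFDeriv ℝ p G x‖ := by
  have h := pow_mul_norm_iteratedFDeriv_fourier_le (f := G) (K := 0) (N := ⊤) hG
    (fun k p _ _ => by
      refine Continuous.integrable_of_hasCompactSupport ?_ ?_
      · exact (continuous_norm.pow k).mul
          (hG.continuous_iteratedFDeriv (by exact_mod_cast le_top)).norm
      · exact (hGc.iteratedFDeriv p).norm.mul_left) (k := 0) (n := N) le_rfl le_top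
      ((-(2 * π)⁻¹ : ℝ) • w)
  simp only [CharP.cast_eq_zero, mul_zero, zero_add, pow_zero, one_mul, norm_iteratedFDeriv_zero,
    Finset.range_one, Finset.sum_product, Finset.sum_singleton] at h
  have e : 𝓕 G ((-(2 * π)⁻¹ : ℝ) • w) =
      ∫ x, Complex.exp (Complex.I * ((⟪x, w⟫_ℝ : ℝ) : ℂ)) * G x := by
    rw [Real.fourier_eq']
    refine integral_congr_ae (Filter.Eventually.of_forall fun x => ?_)
    have : -2 * π * ⟪x, (-(2 * π)⁻¹ : ℝ) • w⟫_ℝ = ⟪x, w⟫_ℝ := by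
      rw [inner_smul_right]
      field_simp
    simp only [this, smul_eq_mul, mul_comm Complex.I]
  rw [e, norm_smul, mul_pow, norm_neg, Real.norm_of_nonneg (by positivity), inv_pow, mul_assoc,
    inv_mul_le_iff₀ (by positivity)] at h
  refine h.trans (le_of_eq ?_)
  rw [← mul_assoc, ← mul_pow]
  congr 2
  ring

theorem exists_norm_iteratedFDeriv_le {E : Type*} [NormedAddCommGroup E] [NormedSpace ℝ E]
    {ψ : E → ℂ} (hψ : ContDiff ℝ (⊤ : ℕ∞) ψ) (hc : HasCompactSupport ψ) (N : ℕ) :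
    ∃ C : ℝ, 0 ≤ C ∧ ∀ p ≤ N, ∀ x, ‖iteratedFDeriv ℝ p ψ x‖ ≤ C := by
  have h : ∀ p : ℕ, ∃ C, ∀ x, ‖iteratedFDeriv ℝ p ψ x‖ ≤ C := fun p =>
    (hc.iteratedFDeriv p).exists_bound_of_continuous
      (hψ.continuous_iteratedFDeriv (by exact_mod_cast le_top))
  choose C hC using h
  refine ⟨∑ p ∈ Finset.range (N + 1), |C p|, Finset.sum_nonneg fun p _ => abs_nonneg _,
    fun p hp x => (hC p x).trans ((le_abs_self _).trans ?_)⟩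
  exact Finset.single_le_sum (f := fun p => |C p|) (fun p _ => abs_nonneg _)
    (Finset.mem_range.2 (Nat.lt_succ_of_le hp))

theorem one_add_pow_le {t : ℝ} (ht : 0 ≤ t) (N : ℕ) : (1 + t) ^ N ≤ 2 ^ N * (1 + t ^ N) := by
  rcases le_total t 1 with h | h
  · calc (1 + t) ^ N ≤ 2 ^ N := by gcongr; linarith
      _ ≤ _ := le_mul_of_one_le_right (by positivity) (by linarith [pow_nonneg ht N])
  · calc (1 + t) ^ N ≤ (2 * t) ^ N := by gcongr; linarith
      _ = 2 ^ N * t ^ N := mul_pow _ _ _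
      _ ≤ _ := by gcongr; linarith

theorem integral_norm_iteratedFDeriv_le {n : ℕ} {G : Rn n → ℂ} {p : ℕ}
    {S : Set (Rn n)} (hS : IsCompact S) (hGS : tsupport G ⊆ S) {c : ℝ}
    (hc : ∀ x, ‖iteratedFDeriv ℝ p G x‖ ≤ c) :
    ∫ x, ‖iteratedFDeriv ℝ p G x‖ ≤ c * volume.real S := by
  have h0 : ∀ x, x ∉ S → ‖iteratedFDeriv ℝ p G x‖ = 0 := fun x hx => by
    rw [norm_eq_zero]
    exact image_eq_zero_of_notMem_tsupport
      (fun h => hx (hGS (tsupport_iteratedFDeriv_subset p h)))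
  rw [← setIntegral_eq_integral_of_forall_compl_eq_zero h0]
  refine (le_abs_self _).trans ?_
  exact norm_setIntegral_le_of_norm_le_const (f := fun x => ‖iteratedFDeriv ℝ p G x‖)
    (hS.measure_lt_top (μ := volume)) fun x _ => (norm_norm _).trans_le (hc x)

theorem exists_norm_integral_exp_mul_mul_le {n : ℕ} {ψ : Rn n → ℂ}
    (hψ : ContDiff ℝ (⊤ : ℕ∞) ψ) (hψc : HasCompactSupport ψ) (N : ℕ) :
    ∃ C : ℝ, 0 ≤ C ∧ ∀ (b₁ b₂ : Rn n → ℂ) (F₁ F₂ R : ℝ) (w : Rn n), 0 ≤ F₁ → 0 ≤ F₂ → 1 ≤ R →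
      ContDiff ℝ (⊤ : ℕ∞) b₁ → ContDiff ℝ (⊤ : ℕ∞) b₂ →
      (∀ p ≤ N, ∀ x, ‖iteratedFDeriv ℝ p b₁ x‖ ≤ F₁ * R ^ p) →
      (∀ p ≤ N, ∀ x, ‖iteratedFDeriv ℝ p b₂ x‖ ≤ F₂ * R ^ p) →
      (1 + ‖w‖ / R) ^ N *
        ‖∫ x, Complex.exp (Complex.I * ((⟪x, w⟫_ℝ : ℝ) : ℂ)) * (ψ x * (b₁ x * b₂ x))‖ ≤
          C * (F₁ * F₂) := by
  obtain ⟨D, hD0, hD⟩ := exists_norm_iteratedFDeriv_le hψ hψc N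
  set v := volume.real (tsupport ψ) with hv
  have hv0 : 0 ≤ v := measureReal_nonneg
  set c : ℝ := 2 ^ N * (D * 2 ^ N) * v with hc
  have hc0 : 0 ≤ c := by positivity
  refine ⟨2 ^ N * (c + (4 * π) ^ N * ((N + 1) * c)), by positivity, ?_⟩
  intro b₁ b₂ F₁ F₂ R w hF₁ hF₂ hR hb₁ hb₂ hd₁ hd₂
  have hR0 : 0 < R := by linarith
  set G : Rn n → ℂ := fun x => ψ x * (b₁ x * b₂ x) with hG
  have hbb : ContDiff ℝ (⊤ : ℕ∞) fun x => b₁ x * b₂ x := hb₁.mul hb₂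
  have hGd : ContDiff ℝ (⊤ : ℕ∞) G := hψ.mul hbb
  have hGc : HasCompactSupport G := hψc.mul_right
  have hGS : tsupport G ⊆ tsupport ψ := closure_mono (Function.support_mul_subset_left _ _)
  have hle : ∀ p : ℕ, ((p : ℕ∞) : WithTop ℕ∞) ≤ ((⊤ : ℕ∞) : WithTop ℕ∞) := fun p => by
    exact_mod_cast le_top
  have hGb : ∀ p ≤ N, ∀ x, ‖iteratedFDeriv ℝ p G x‖ ≤
      2 ^ N * (D * 2 ^ N) * (F₁ * F₂) * R ^ p := by
    intro p hp x
    have h1 : ∀ i ≤ p, ‖iteratedFDeriv ℝ i (fun x => b₁ x * b₂ x) x‖ ≤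
        2 ^ N * (F₁ * F₂) * R ^ i := fun i hi => by
      refine (norm_iteratedFDeriv_mul_le_of_le (hb₁.of_le (hle i)) (hb₂.of_le (hle i)) hF₁ hR0.le
        (fun j hj => hd₁ j (by omega) x) (fun j hj => hd₂ j (by omega) x)).trans ?_
      gcongr
      · norm_num
      · omega
    refine (norm_iteratedFDeriv_mul_le_of_le (hψ.of_le (hle p)) (hbb.of_le (hle p)) hD0 hR0.le
      (fun i hi => (hD i (by omega) x).trans (le_mul_of_one_le_right hD0 (one_le_pow₀ hR)))
      h1).trans ?_
    have : 2 ^ N * (D * 2 ^ N) * (F₁ * F₂) * R ^ p = 2 ^ N * (D * (2 ^ N * (F₁ * F₂))) * R ^ p := by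
      ring
    rw [this]
    gcongr
    norm_num
  have hInt : ∀ p ≤ N, ∫ x, ‖iteratedFDeriv ℝ p G x‖ ≤ c * (F₁ * F₂) * R ^ p := fun p hp => by
    refine (integral_norm_iteratedFDeriv_le hψc hGS (hGb p hp)).trans (le_of_eq ?_)
    rw [hc, ← hv]
    ring
  set I := ‖∫ x, Complex.exp (Complex.I * ((⟪x, w⟫_ℝ : ℝ) : ℂ)) * G x‖ with hI
  have hI0 : 0 ≤ I := norm_nonneg _
  have e0 : I ≤ c * (F₁ * F₂) := by
    have := pow_mul_norm_integral_exp_mul_le hGd hGc 0 w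
    simp only [pow_zero, one_mul, zero_add, Finset.range_one, Finset.sum_singleton] at this
    simpa using this.trans (hInt 0 (Nat.zero_le _))
  have eN : ‖w‖ ^ N * I ≤ (4 * π) ^ N * ((N + 1) * c) * (F₁ * F₂) * R ^ N := by
    refine (pow_mul_norm_integral_exp_mul_le hGd hGc N w).trans ?_
    have : ∑ p ∈ Finset.range (N + 1), ∫ x, ‖iteratedFDeriv ℝ p G x‖ ≤
        ∑ p ∈ Finset.range (N + 1), c * (F₁ * F₂) * R ^ N := by
      refine Finset.sum_le_sum fun p hp => ?_
      have hp : p ≤ N := Nat.lt_succ_iff.1 (Finset.mem_range.1 hp)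
      refine (hInt p hp).trans ?_
      gcongr
    rw [Finset.sum_const, Finset.card_range, nsmul_eq_mul] at this
    calc _ ≤ (4 * π) ^ N * (((N + 1 : ℕ) : ℝ) * (c * (F₁ * F₂) * R ^ N)) := by gcongr
      _ = _ := by push_cast; ring
  calc (1 + ‖w‖ / R) ^ N * I ≤ 2 ^ N * (1 + (‖w‖ / R) ^ N) * I := by
        gcongr
        exact one_add_pow_le (by positivity) N
    _ = 2 ^ N * (I + (‖w‖ ^ N * I) / R ^ N) := by rw [div_pow]; ring
    _ ≤ 2 ^ N * (c * (F₁ * F₂) + (4 * π) ^ N * ((N + 1) * c) * (F₁ * F₂)) := by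
        gcongr
        rw [div_le_iff₀ (by positivity)]
        exact eN
    _ = _ := by ring

/-- A smooth cutoff which equals one on `closedBall 0 r` and vanishes outside `ball 0 (r + 1)`. -/
theorem exists_cutoff (n : ℕ) {r : ℝ} (hr : 0 < r) : ∃ φ : Rn n → ℝ,
    ContDiff ℝ (⊤ : ℕ∞) φ ∧ HasCompactSupport φ ∧ (∀ x, 0 ≤ φ x) ∧ (∀ x, φ x ≤ 1) ∧
      (∀ x, ‖x‖ ≤ r → φ x = 1) ∧ ∀ x, r + 1 ≤ ‖x‖ → φ x = 0 := by
  let φ : ContDiffBump (0 : Rn n) := ⟨r, r + 1, hr, by linarith⟩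
  refine ⟨φ, φ.contDiff, φ.hasCompactSupport, fun x => φ.nonneg, fun x => φ.le_one,
    fun x hx => φ.one_of_mem_closedBall (by simpa using hx),
    fun x hx => φ.zero_of_le_dist (by simpa using hx)⟩

open scoped ComplexConjugate in
theorem integrable_oscillatory_square {n : ℕ} {B : Rn n → Rn n → ℂ} {K : Set (Rn n)}
    {ψ : Rn n → ℂ} (hψ : Continuous ψ) (hψc : HasCompactSupport ψ) (hK : IsCompact K)
    (hB : Continuous (Function.uncurry B)) (hBK : ∀ ξ, ξ ∉ K → ∀ x, B x ξ = 0) :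
    Integrable (fun q : Rn n × Rn n × Rn n =>
      ψ q.1 * ((Complex.exp (Complex.I * ((⟪q.1, q.2.1⟫_ℝ : ℝ) : ℂ)) * B q.1 q.2.1) *
        conj (Complex.exp (Complex.I * ((⟪q.1, q.2.2⟫_ℝ : ℝ) : ℂ)) * B q.1 q.2.2)))
      (volume.prod (volume.prod volume)) := by
  have hB1 : Continuous fun q : Rn n × Rn n × Rn n => B q.1 q.2.1 :=
    hB.comp (g := Function.uncurry B) (f := fun q : Rn n × Rn n × Rn n => (q.1, q.2.1))
      (by fun_prop)
  have hB2 : Continuous fun q : Rn n × Rn n × Rn n => B q.1 q.2.2 :=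
    hB.comp (g := Function.uncurry B) (f := fun q : Rn n × Rn n × Rn n => (q.1, q.2.2))
      (by fun_prop)
  refine Continuous.integrable_of_hasCompactSupport ?_ ?_
  · refine (hψ.comp continuous_fst).mul (Continuous.mul (Continuous.mul ?_ hB1)
      (Complex.continuous_conj.comp (Continuous.mul ?_ hB2)))
    · fun_prop
    · fun_prop
  · refine HasCompactSupport.intro (hψc.prod (hK.prod hK)) fun q hq => ?_
    simp only [Set.mem_prod, not_and_or] at hq
    rcases hq with h | h | h
    · rw [image_eq_zero_of_notMem_tsupport h, zero_mul]
    · rw [hBK _ h]; simp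
    · rw [hBK _ h]; simp

open scoped ComplexConjugate in
theorem exists_norm_integral_exp_mul_conj_le {n : ℕ} {δ : ℝ} (hδ0 : 0 ≤ δ) (hδ1 : δ < 1)
    {ψ : Rn n → ℂ} (hψ : ContDiff ℝ (⊤ : ℕ∞) ψ) (hψc : HasCompactSupport ψ) :
    ∃ (N : ℕ) (C : ℝ), 0 ≤ C ∧ ∀ (A : ℝ) (b₁ b₂ : Rn n → ℂ) (ξ η : Rn n), 0 ≤ A →
      ContDiff ℝ (⊤ : ℕ∞) b₁ → ContDiff ℝ (⊤ : ℕ∞) b₂ →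
      (∀ p ≤ N, ∀ x, ‖iteratedFDeriv ℝ p b₁ x‖ ≤
        A * ((1 + ‖ξ‖) ^ n)⁻¹ * ((1 + ‖ξ‖) ^ δ) ^ p) →
      (∀ p ≤ N, ∀ x, ‖iteratedFDeriv ℝ p b₂ x‖ ≤
        A * ((1 + ‖η‖) ^ n)⁻¹ * ((1 + ‖η‖) ^ δ) ^ p) →
      ‖∫ x, Complex.exp (Complex.I * ((⟪x, ξ - η⟫_ℝ : ℝ) : ℂ)) * (ψ x * (b₁ x * conj (b₂ x)))‖ ≤
        C * A ^ 2 * (schurMajorant δ ξ η + schurMajorant δ η ξ) := by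
  set k := ⌈(n : ℝ) / (1 - δ)⌉₊ with hk
  have hk' : (n : ℝ) ≤ (1 - δ) * k := by
    have := Nat.le_ceil ((n : ℝ) / (1 - δ))
    rw [div_le_iff₀ (by linarith)] at this
    linarith
  obtain ⟨C, hC0, hC⟩ := exists_norm_integral_exp_mul_mul_le hψ hψc (n + 1 + k)
  refine ⟨n + 1 + k, C * 2 ^ k, by positivity, ?_⟩
  intro A b₁ b₂ ξ η hA hb₁ hb₂ hd₁ hd₂
  have hσ : 1 ≤ 1 + ‖ξ‖ := by simp
  have hτ : 1 ≤ 1 + ‖η‖ := by simp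
  have hconj : ContDiff ℝ (⊤ : ℕ∞) fun x => conj (b₂ x) := Complex.conjCLE.contDiff.comp hb₂
  have hconjd : ∀ p x, ‖iteratedFDeriv ℝ p (fun x => conj (b₂ x)) x‖ =
      ‖iteratedFDeriv ℝ p b₂ x‖ := fun p x =>
    Complex.conjLIE.norm_iteratedFDeriv_comp_left b₂ x p
  have main : ∀ R : ℝ, (1 + ‖ξ‖) ^ δ ≤ R → (1 + ‖η‖) ^ δ ≤ R →
      ‖∫ x, Complex.exp (Complex.I * ((⟪x, ξ - η⟫_ℝ : ℝ) : ℂ)) *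
        (ψ x * (b₁ x * conj (b₂ x)))‖ ≤
      C * A ^ 2 * (((1 + ‖ξ‖) ^ n)⁻¹ * ((1 + ‖η‖) ^ n)⁻¹ *
        ((1 + ‖ξ - η‖ / R) ^ (n + 1 + k))⁻¹) := by
    intro R h1 h2
    have hR : 1 ≤ R := (one_le_rpow hσ hδ0).trans h1
    have := hC b₁ (fun x => conj (b₂ x)) (A * ((1 + ‖ξ‖) ^ n)⁻¹)
      (A * ((1 + ‖η‖) ^ n)⁻¹) R (ξ - η) (by positivity) (by positivity) hR hb₁ hconj
      (fun p hp x => (hd₁ p hp x).trans (by gcongr))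
      (fun p hp x => (hconjd p x).trans_le ((hd₂ p hp x).trans (by gcongr)))
    rw [mul_comm, ← le_div_iff₀ (by positivity)] at this
    refine this.trans (le_of_eq ?_)
    rw [div_eq_mul_inv]
    ring
  have hCA : 0 ≤ C * A ^ 2 := by positivity
  rcases le_total ‖η‖ ‖ξ‖ with h | h
  · refine (main ((1 + ‖ξ‖) ^ δ) le_rfl (by gcongr)).trans ?_
    have := weight_le_schurMajorant hδ0 hk' h
    calc _ ≤ C * A ^ 2 * (2 ^ k * schurMajorant δ ξ η) := by gcongr
      _ ≤ C * A ^ 2 * (2 ^ k * (schurMajorant δ ξ η + schurMajorant δ η ξ)) := by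
          gcongr
          linarith [schurMajorant_nonneg δ η ξ]
      _ = _ := by ring
  · refine (main ((1 + ‖η‖) ^ δ) (by gcongr) le_rfl).trans ?_
    have := weight_le_schurMajorant hδ0 hk' h
    rw [norm_sub_rev, mul_comm ((1 + ‖ξ‖) ^ n)⁻¹]
    calc _ ≤ C * A ^ 2 * (2 ^ k * schurMajorant δ η ξ) := by gcongr
      _ ≤ C * A ^ 2 * (2 ^ k * (schurMajorant δ ξ η + schurMajorant δ η ξ)) := by
          gcongr
          linarith [schurMajorant_nonneg δ ξ η]
      _ = _ := by ring

open scoped ComplexConjugate in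
theorem lintegral_mul_sq_norm_integral_le {n : ℕ} {u : Rn n → Rn n → ℂ} {φ : Rn n → ℝ}
    (hφ : ∀ x, 0 ≤ φ x) {g : Rn n → Rn n → ℝ≥0∞}
    (hH : Integrable (fun q : Rn n × Rn n × Rn n =>
      (φ q.1 : ℂ) * (u q.1 q.2.1 * conj (u q.1 q.2.2))) (volume.prod (volume.prod volume)))
    (hg : ∀ ξ η, ‖∫ x, (φ x : ℂ) * (u x ξ * conj (u x η))‖ₑ ≤ g ξ η) :
    ∫⁻ x, ENNReal.ofReal (φ x * ‖∫ ξ, u x ξ‖ ^ 2) ≤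
      ∫⁻ p : Rn n × Rn n, g p.1 p.2 ∂(volume.prod volume) := by
  have hHF : ∀ x, ∫ p : Rn n × Rn n, (φ x : ℂ) * (u x p.1 * conj (u x p.2))
      ∂(volume.prod volume) = ((φ x * ‖∫ ξ, u x ξ‖ ^ 2 : ℝ) : ℂ) := by
    intro x
    rw [integral_const_mul, integral_prod_mul (u x) (fun η => conj (u x η)), integral_conj,
      Complex.mul_conj, Complex.normSq_eq_norm_sq, ← Complex.ofReal_mul]
  have hInt : Integrable (fun x => ((φ x * ‖∫ ξ, u x ξ‖ ^ 2 : ℝ) : ℂ)) volume := by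
    have := hH.integral_prod_left
    simp_rw [hHF] at this
    exact this
  have hInt' : Integrable (fun x => φ x * ‖∫ ξ, u x ξ‖ ^ 2) volume := by
    exact hInt.re.congr (Filter.Eventually.of_forall fun x => Complex.ofReal_re _)
  calc ∫⁻ x, ENNReal.ofReal (φ x * ‖∫ ξ, u x ξ‖ ^ 2)
      = ENNReal.ofReal (∫ x, φ x * ‖∫ ξ, u x ξ‖ ^ 2) :=
        (ofReal_integral_eq_lintegral_ofReal hInt' (Filter.Eventually.of_forall fun x =>
          mul_nonneg (hφ x) (sq_nonneg _))).symm
    _ ≤ ENNReal.ofReal ‖∫ x, ((φ x * ‖∫ ξ, u x ξ‖ ^ 2 : ℝ) : ℂ)‖ := by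
        rw [integral_complex_ofReal, Complex.norm_real]
        exact ENNReal.ofReal_le_ofReal (le_abs_self _)
    _ = ‖∫ x, ∫ p : Rn n × Rn n, (φ x : ℂ) * (u x p.1 * conj (u x p.2))
          ∂(volume.prod volume)‖ₑ := by
        simp_rw [hHF]
        exact ofReal_norm _
    _ = ‖∫ p : Rn n × Rn n, ∫ x, (φ x : ℂ) * (u x p.1 * conj (u x p.2)) ∂volume
          ∂(volume.prod volume)‖ₑ := by
        congr 1
        exact integral_integral_swap
          (f := fun x (p : Rn n × Rn n) => (φ x : ℂ) * (u x p.1 * conj (u x p.2))) hH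
    _ ≤ ∫⁻ p : Rn n × Rn n, ‖∫ x, (φ x : ℂ) * (u x p.1 * conj (u x p.2))‖ₑ
          ∂(volume.prod volume) := enorm_integral_le_lintegral_enorm _
    _ ≤ _ := lintegral_mono fun p => hg p.1 p.2

open scoped ComplexConjugate in
theorem mul_exp_mul_conj_exp_mul {n : ℕ} (x ξ η : Rn n) (c b₁ b₂ : ℂ) :
    c * ((Complex.exp (Complex.I * ((⟪x, ξ⟫_ℝ : ℝ) : ℂ)) * b₁) *
      conj (Complex.exp (Complex.I * ((⟪x, η⟫_ℝ : ℝ) : ℂ)) * b₂)) =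
      Complex.exp (Complex.I * ((⟪x, ξ - η⟫_ℝ : ℝ) : ℂ)) * (c * (b₁ * conj b₂)) := by
  have : Complex.exp (Complex.I * ((⟪x, ξ - η⟫_ℝ : ℝ) : ℂ)) =
      Complex.exp (Complex.I * ((⟪x, ξ⟫_ℝ : ℝ) : ℂ)) *
        Complex.exp (-(Complex.I * ((⟪x, η⟫_ℝ : ℝ) : ℂ))) := by
    rw [inner_sub_right, Complex.ofReal_sub, mul_sub, sub_eq_add_neg, Complex.exp_add]
  simp only [map_mul, ← Complex.exp_conj, Complex.conj_I, Complex.conj_ofReal, neg_mul]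
  rw [this]
  ring

open scoped ComplexConjugate in
/-- Local square function estimate at unit scale for symbols of type `(0, δ)` and order `-n`,
proved by estimating the kernel of `T* T`. -/
theorem exists_lintegral_unit_cube_sq_le {n : ℕ} (hn : 1 ≤ n) {δ : ℝ} (hδ0 : 0 ≤ δ)
    (hδ1 : δ < 1) : ∃ (N : ℕ) (C : ℝ), 0 ≤ C ∧
      ∀ (A : ℝ) (B : Rn n → Rn n → ℂ) (K : Set (Rn n)), 0 ≤ A → IsCompact K →
      Continuous (Function.uncurry B) → (∀ ξ, ξ ∉ K → ∀ x, B x ξ = 0) →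
      (∀ ξ, ContDiff ℝ (⊤ : ℕ∞) fun x => B x ξ) →
      (∀ p ≤ N, ∀ x ξ, ‖iteratedFDeriv ℝ p (fun x => B x ξ) x‖ ≤
        A * ((1 + ‖ξ‖) ^ n)⁻¹ * ((1 + ‖ξ‖) ^ δ) ^ p) →
      ∫⁻ x in cube 0 1, ‖∫ ξ, Complex.exp (Complex.I * ((⟪x, ξ⟫_ℝ : ℝ) : ℂ)) * B x ξ‖ₑ ^ 2 ≤
        ENNReal.ofReal (C * A ^ 2) := by
  obtain ⟨φ, hφ, hφc, hφ0, -, hφ1, -⟩ := exists_cutoff n (r := n + 1) (by positivity)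
  have hψ : ContDiff ℝ (⊤ : ℕ∞) fun x => (φ x : ℂ) := Complex.ofRealCLM.contDiff.comp hφ
  have hψc : HasCompactSupport fun x => (φ x : ℂ) :=
    hφc.comp_left (g := ((↑) : ℝ → ℂ)) Complex.ofReal_zero
  obtain ⟨N, C, hC0, hC⟩ := exists_norm_integral_exp_mul_conj_le hδ0 hδ1 hψ hψc
  have hJt : ∫⁻ ξ : Rn n, ∫⁻ η : Rn n, ENNReal.ofReal (schurMajorant δ ξ η) < ∞ :=
    lintegral_schurMajorant_lt_top hn hδ1
  generalize hJ : ∫⁻ ξ : Rn n, ∫⁻ η : Rn n, ENNReal.ofReal (schurMajorant δ ξ η) = J at hJt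
  refine ⟨N, C * (2 * J.toReal), by positivity, ?_⟩
  intro A B K hA hK hBc hBK hBs hBd
  have hcube : ∀ x ∈ cube (0 : Rn n) 1, φ x = 1 := fun x hx => hφ1 x (by
    have := norm_sub_le_of_mem_cube hx
    simp only [sub_zero, mul_one] at this
    linarith)
  have hm1 : Measurable fun p : Rn n × Rn n => ENNReal.ofReal (schurMajorant δ p.1 p.2) :=
    (continuous_schurMajorant δ).measurable.ennreal_ofReal
  have hm2 : Measurable fun p : Rn n × Rn n => ENNReal.ofReal (schurMajorant δ p.2 p.1) :=
    ((continuous_schurMajorant δ).comp continuous_swap).measurable.ennreal_ofReal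
  have key := lintegral_mul_sq_norm_integral_le
    (u := fun x ξ => Complex.exp (Complex.I * ((⟪x, ξ⟫_ℝ : ℝ) : ℂ)) * B x ξ) hφ0
    (g := fun ξ η => ENNReal.ofReal (C * A ^ 2) *
      (ENNReal.ofReal (schurMajorant δ ξ η) + ENNReal.ofReal (schurMajorant δ η ξ)))
    (integrable_oscillatory_square hψ.continuous hψc hK hBc hBK) (fun ξ η => by
      simp_rw [mul_exp_mul_conj_exp_mul]
      rw [← ENNReal.ofReal_add (schurMajorant_nonneg _ _ _) (schurMajorant_nonneg _ _ _),
        ← ENNReal.ofReal_mul (by positivity), ← ofReal_norm]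
      exact ENNReal.ofReal_le_ofReal
        (hC A (fun x => B x ξ) (fun x => B x η) ξ η hA (hBs ξ) (hBs η)
          (fun p hp x => hBd p hp x ξ) (fun p hp x => hBd p hp x η)))
  calc _ = ∫⁻ x in cube 0 1, ENNReal.ofReal
        (φ x * ‖∫ ξ, Complex.exp (Complex.I * ((⟪x, ξ⟫_ℝ : ℝ) : ℂ)) * B x ξ‖ ^ 2) := by
        refine setLIntegral_congr_fun (measurableSet_cube _ _) fun x hx => ?_
        rw [hcube x hx, one_mul, ENNReal.ofReal_pow (norm_nonneg _), ofReal_norm]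
    _ ≤ _ := setLIntegral_le_lintegral _ _
    _ ≤ _ := key
    _ = ENNReal.ofReal (C * A ^ 2) * (J + J) := by
        rw [lintegral_const_mul' _ _ ENNReal.ofReal_ne_top, lintegral_add_left hm1,
          lintegral_prod _ hm1.aemeasurable, lintegral_prod_symm _ hm2.aemeasurable, hJ]
    _ = _ := by
        have h2 : J + J = ENNReal.ofReal (2 * J.toReal) := by
          rw [ENNReal.ofReal_mul zero_le_two, ENNReal.ofReal_toReal hJt.ne, ← two_mul]
          simp
        rw [h2, ← ENNReal.ofReal_mul (by positivity)]
        congr 1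
        ring

theorem contDiff_uncurry_fderiv {n : ℕ} {E : Type*} [NormedAddCommGroup E] [NormedSpace ℝ E]
    {b : Rn n → Rn n → E} (hb : ContDiff ℝ (⊤ : ℕ∞) (Function.uncurry b)) :
    ContDiff ℝ (⊤ : ℕ∞) (Function.uncurry fun x ξ => fderiv ℝ (b x) ξ) := by
  refine ContDiff.fderiv (f := fun (p : Rn n × Rn n) ξ => b p.1 ξ) (g := fun p => p.2)
    (n := (⊤ : ℕ∞)) ?_ contDiff_snd (by norm_cast)
  exact hb.comp (contDiff_fst.fst.prodMk contDiff_snd)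

theorem contDiff_uncurry_iteratedFDeriv {n : ℕ} {b : Rn n → Rn n → ℂ}
    (hb : ContDiff ℝ (⊤ : ℕ∞) (Function.uncurry b)) (k : ℕ) :
    ContDiff ℝ (⊤ : ℕ∞) (Function.uncurry fun x ξ => iteratedFDeriv ℝ k (b x) ξ) := by
  induction k with
  | zero =>
    simp only [iteratedFDeriv_zero_eq_comp]
    exact (continuousMultilinearCurryFin0 ℝ (Rn n) ℂ).symm.contDiff.comp hb
  | succ k ih =>
    simp only [iteratedFDeriv_succ_eq_comp_left]
    exact (continuousMultilinearCurryLeftEquiv ℝ (fun _ : Fin (k + 1) => Rn n) ℂ).symm.contDiff.comp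
      (contDiff_uncurry_fderiv ih)

theorem contDiff_slice_left {n : ℕ} {E : Type*} [NormedAddCommGroup E] [NormedSpace ℝ E]
    {b : Rn n → Rn n → E} (hb : ContDiff ℝ (⊤ : ℕ∞) (Function.uncurry b)) (ξ : Rn n) :
    ContDiff ℝ (⊤ : ℕ∞) fun x => b x ξ :=
  hb.comp (contDiff_id.prodMk contDiff_const)

theorem contDiff_slice_right {n : ℕ} {E : Type*} [NormedAddCommGroup E] [NormedSpace ℝ E]
    {b : Rn n → Rn n → E} (hb : ContDiff ℝ (⊤ : ℕ∞) (Function.uncurry b)) (x : Rn n) :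
    ContDiff ℝ (⊤ : ℕ∞) (b x) :=
  hb.comp (contDiff_const.prodMk contDiff_id)

theorem iteratedFDeriv_fderiv_apply {n : ℕ} {f : Rn n → ℂ} (hf : ContDiff ℝ (⊤ : ℕ∞) f)
    (v : Rn n) (k : ℕ) (ξ : Rn n) :
    iteratedFDeriv ℝ k (fun η => fderiv ℝ f η v) ξ =
      (ContinuousLinearMap.compContinuousMultilinearMapL ℝ (fun _ : Fin k => Rn n)
        (Rn n →L[ℝ] ℂ) ℂ (ContinuousLinearMap.apply ℝ ℂ v))
        (continuousMultilinearCurryRightEquiv' ℝ k (Rn n) ℂ (iteratedFDeriv ℝ (k + 1) f ξ)) := by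
  have h1 : continuousMultilinearCurryRightEquiv' ℝ k (Rn n) ℂ (iteratedFDeriv ℝ (k + 1) f ξ) =
      iteratedFDeriv ℝ k (fderiv ℝ f) ξ := by
    rw [iteratedFDeriv_succ_eq_comp_right]
    exact LinearIsometryEquiv.apply_symm_apply _ _
  rw [h1]
  have hf' : ContDiff ℝ (⊤ : ℕ∞) (fderiv ℝ f) := hf.fderiv_right (by norm_cast)
  exact (ContinuousLinearMap.apply ℝ ℂ v).iteratedFDeriv_comp_left (i := k)
    (hf'.contDiffAt (x := ξ)) (by exact_mod_cast le_top)

theorem norm_iteratedFDeriv_fderiv_apply_le {n : ℕ} {f : Rn n → ℂ}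
    (hf : ContDiff ℝ (⊤ : ℕ∞) f) (v : Rn n) (k : ℕ) (ξ : Rn n) :
    ‖iteratedFDeriv ℝ k (fun η => fderiv ℝ f η v) ξ‖ ≤ ‖v‖ * ‖iteratedFDeriv ℝ (k + 1) f ξ‖ := by
  rw [iteratedFDeriv_fderiv_apply hf]
  refine (ContinuousLinearMap.norm_compContinuousMultilinearMap_le _ _).trans ?_
  rw [LinearIsometryEquiv.norm_map]
  gcongr
  refine ContinuousLinearMap.opNorm_le_bound _ (norm_nonneg _) fun L => ?_
  rw [mul_comm]
  exact L.le_opNorm v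

theorem HormClass.fderiv_apply {n : ℕ} {m δ : ℝ} {b : Rn n → Rn n → ℂ}
    (hb : HormClass m 0 δ b) (v : Rn n) : HormClass m 0 δ fun x ξ => fderiv ℝ (b x) ξ v := by
  refine ⟨(contDiff_uncurry_fderiv hb.1).clm_apply contDiff_const, fun k l => ?_⟩
  obtain ⟨C, hC, h⟩ := hb.2 (k + 1) l
  set Λ := (ContinuousLinearMap.compContinuousMultilinearMapL ℝ (fun _ : Fin k => Rn n)
        (Rn n →L[ℝ] ℂ) ℂ (ContinuousLinearMap.apply ℝ ℂ v)).comp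
        (continuousMultilinearCurryRightEquiv' ℝ k (Rn n)
          ℂ).toContinuousLinearEquiv.toContinuousLinearMap with hΛ
  refine ⟨(‖Λ‖ + 1) * C, by positivity, fun x ξ => ?_⟩
  have e : (fun y => iteratedFDeriv ℝ k (fun η => fderiv ℝ (b y) η v) ξ) =
      Λ ∘ fun y => iteratedFDeriv ℝ (k + 1) (b y) ξ := by
    funext y
    exact iteratedFDeriv_fderiv_apply (contDiff_slice_right hb.1 y) v k ξ
  have hs : ContDiff ℝ (⊤ : ℕ∞) fun y => iteratedFDeriv ℝ (k + 1) (b y) ξ :=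
    contDiff_slice_left (contDiff_uncurry_iteratedFDeriv hb.1 (k + 1)) ξ
  rw [e]
  refine (Λ.norm_iteratedFDeriv_comp_left (hs.contDiffAt) (by exact_mod_cast le_top)).trans ?_
  have := h x ξ
  rw [zero_mul, sub_zero] at this ⊢
  rw [mul_assoc]
  gcongr
  linarith

theorem japanese_bracket_rpow_le {n : ℕ} {δ : ℝ} (hδ : 0 ≤ δ) (l : ℕ) (t : ℝ) (ht : 0 ≤ t) :
    (1 + t ^ 2) ^ ((-(n : ℝ) + δ * l) / 2) ≤
      2 ^ n * (((1 + t) ^ n)⁻¹ * ((1 + t) ^ δ) ^ l) := by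
  have h0 : (0 : ℝ) < 1 + t ^ 2 := by positivity
  have h1 : (0 : ℝ) < 1 + t := by positivity
  rw [add_div, rpow_add h0, ← mul_assoc]
  have e1 : (1 + t ^ 2) ^ (-(n : ℝ) / 2) ≤ 2 ^ n * ((1 + t) ^ n)⁻¹ := by
    have h2 : ((1 + t) / 2) ^ 2 ≤ 1 + t ^ 2 := by nlinarith [sq_nonneg (t - 1)]
    calc (1 + t ^ 2) ^ (-(n : ℝ) / 2) ≤ (((1 + t) / 2) ^ 2) ^ (-(n : ℝ) / 2) :=
          rpow_le_rpow_of_nonpos (by positivity) h2 (by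
            have : (0 : ℝ) ≤ n := n.cast_nonneg
            linarith)
      _ = ((1 + t) / 2) ^ (-(n : ℝ)) := by
          rw [← rpow_natCast, ← rpow_mul (by positivity)]
          congr 1
          push_cast
          ring
      _ = _ := by
          rw [rpow_neg (by positivity), rpow_natCast, div_pow, inv_div, div_eq_mul_inv]
  have e2 : (1 + t ^ 2) ^ (δ * l / 2) ≤ ((1 + t) ^ δ) ^ l := by
    have h2 : 1 + t ^ 2 ≤ (1 + t) ^ 2 := by nlinarith
    calc (1 + t ^ 2) ^ (δ * l / 2) ≤ ((1 + t) ^ 2) ^ (δ * l / 2) := by gcongr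
      _ = _ := by
          rw [← rpow_natCast, ← rpow_mul h1.le, ← rpow_natCast, ← rpow_mul h1.le]
          congr 1
          push_cast
          ring
  gcongr

theorem HormClass.exists_norm_iteratedFDeriv_iteratedFDeriv_le {n : ℕ} {δ : ℝ} (hδ : 0 ≤ δ)
    {b : Rn n → Rn n → ℂ} (hb : HormClass (-(n : ℝ)) 0 δ b) (N : ℕ) :
    ∃ C : ℝ, 0 ≤ C ∧ ∀ k ≤ N, ∀ l ≤ N, ∀ x ξ : Rn n,
      ‖iteratedFDeriv ℝ l (fun y => iteratedFDeriv ℝ k (b y) ξ) x‖ ≤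
        C * ((1 + ‖ξ‖) ^ n)⁻¹ * ((1 + ‖ξ‖) ^ δ) ^ l := by
  choose C hC h using hb.2
  refine ⟨(∑ k ∈ Finset.range (N + 1), ∑ l ∈ Finset.range (N + 1), C k l) * 2 ^ n,
    mul_nonneg (Finset.sum_nonneg fun k _ => Finset.sum_nonneg fun l _ => (hC k l).le)
      (by positivity), fun k hk l hl x ξ => (h k l x ξ).trans ?_⟩
  have hs : C k l ≤ ∑ k ∈ Finset.range (N + 1), ∑ l ∈ Finset.range (N + 1), C k l :=
    (Finset.single_le_sum (f := fun l => C k l) (fun l _ => (hC k l).le)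
      (Finset.mem_range.2 (Nat.lt_succ_of_le hl))).trans
    (Finset.single_le_sum (f := fun k => ∑ l ∈ Finset.range (N + 1), C k l)
      (fun k _ => Finset.sum_nonneg fun l _ => (hC k l).le)
      (Finset.mem_range.2 (Nat.lt_succ_of_le hk)))
  rw [zero_mul, sub_zero, mul_assoc, mul_assoc]
  have := japanese_bracket_rpow_le (n := n) hδ l ‖ξ‖ (norm_nonneg ξ)
  have h0 := (hC k l).le
  have hs0 := h0.trans hs
  gcongr

theorem HormClass.exists_norm_iteratedFDeriv_le {n : ℕ} {δ : ℝ} (hδ : 0 ≤ δ)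
    {b : Rn n → Rn n → ℂ} (hb : HormClass (-(n : ℝ)) 0 δ b) (N : ℕ) :
    ∃ C : ℝ, 0 ≤ C ∧ ∀ l ≤ N, ∀ x ξ : Rn n, ‖iteratedFDeriv ℝ l (fun y => b y ξ) x‖ ≤
        C * ((1 + ‖ξ‖) ^ n)⁻¹ * ((1 + ‖ξ‖) ^ δ) ^ l := by
  obtain ⟨C, hC, h⟩ := hb.exists_norm_iteratedFDeriv_iteratedFDeriv_le hδ N
  refine ⟨C, hC, fun l hl x ξ => le_trans (le_of_eq ?_) (h 0 (Nat.zero_le _) l hl x ξ)⟩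
  simp only [iteratedFDeriv_zero_eq_comp, Function.comp_apply]
  exact ((continuousMultilinearCurryFin0 ℝ (Rn n) ℂ).symm.norm_iteratedFDeriv_comp_left
    (fun y => b y ξ) x l).symm

theorem lintegral_cube_eq_lintegral_unit_cube {n : ℕ} (g : Rn n → ℝ≥0∞) (z : Rn n) {l : ℝ}
    (hl : 0 < l) :
    ∫⁻ x in cube z l, g x = ENNReal.ofReal (l ^ n) * ∫⁻ x in cube 0 1, g (z + l • x) := by
  have hmem : ∀ x : Rn n, z + l • x ∈ cube z l ↔ x ∈ cube (0 : Rn n) 1 := fun x => by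
    refine forall_congr' fun i => ?_
    simp only [PiLp.add_apply, PiLp.smul_apply, smul_eq_mul, add_sub_cancel_left, PiLp.zero_apply,
      sub_zero, abs_mul, abs_of_pos hl]
    constructor
    · intro h
      exact le_of_mul_le_mul_left (by linarith) hl
    · intro h
      nlinarith
  rw [← lintegral_indicator (measurableSet_cube z l), ← lintegral_indicator
    (measurableSet_cube _ _), ← lintegral_add_left_eq_self _ z]
  have : (cube (0 : Rn n) 1).indicator (fun x => g (z + l • x)) =
      fun x => (fun w => (cube z l).indicator g (z + w)) (l • x) := by
    funext x
    by_cases h : x ∈ cube (0 : Rn n) 1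
    · rw [Set.indicator_of_mem h]
      exact (Set.indicator_of_mem ((hmem x).2 h) g).symm
    · rw [Set.indicator_of_notMem h]
      exact (Set.indicator_of_notMem (fun h' => h ((hmem x).1 h')) g).symm
  rw [this, lintegral_smul_eq _ hl, ← mul_assoc, ← ENNReal.ofReal_mul (by positivity),
    mul_inv_cancel₀ (by positivity), ENNReal.ofReal_one, one_mul]

/-- The kernel of the operator with compactly supported symbol `b(x,ξ)θ(ξ)`. -/
def oscKernel {n : ℕ} (b : Rn n → Rn n → ℂ) (θ : Rn n → ℂ) (x y : Rn n) : ℂ :=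
  ∫ ξ, Complex.exp (Complex.I * ((⟪x - y, ξ⟫_ℝ : ℝ) : ℂ)) * (b x ξ * θ ξ)

theorem oscKernel_add_smul {n : ℕ} (b : Rn n → Rn n → ℂ) (θ : Rn n → ℂ) (z y x : Rn n) {l : ℝ}
    (hl : 0 < l) :
    oscKernel b θ (z + l • x) y = ∫ ξ, Complex.exp (Complex.I * ((⟪x, ξ⟫_ℝ : ℝ) : ℂ)) *
      ((((l⁻¹ ^ n : ℝ) : ℂ) * (Complex.exp (Complex.I * ((⟪z - y, l⁻¹ • ξ⟫_ℝ : ℝ) : ℂ)) *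
        θ (l⁻¹ • ξ))) * b (z + l • x) (l⁻¹ • ξ)) := by
  have h := Measure.integral_comp_smul (volume : Measure (Rn n)) (fun ξ =>
    Complex.exp (Complex.I * ((⟪z + l • x - y, ξ⟫_ℝ : ℝ) : ℂ)) * (b (z + l • x) ξ * θ ξ)) l⁻¹
  have hl' : (0 : ℝ) < l⁻¹ ^ n := by positivity
  rw [finrank_euclideanSpace_fin, abs_of_pos (by positivity), ← Complex.coe_smul, smul_eq_mul] at h
  have h2 : oscKernel b θ (z + l • x) y = ((l⁻¹ ^ n : ℝ) : ℂ) *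
      ∫ ξ, Complex.exp (Complex.I * ((⟪z + l • x - y, l⁻¹ • ξ⟫_ℝ : ℝ) : ℂ)) *
        (b (z + l • x) (l⁻¹ • ξ) * θ (l⁻¹ • ξ)) := by
    rw [h, ← mul_assoc, ← Complex.ofReal_mul, mul_inv_cancel₀ hl'.ne', Complex.ofReal_one, one_mul]
    rfl
  rw [h2, ← integral_const_mul]
  congr 1
  funext ξ
  have h3 : ⟪z + l • x - y, l⁻¹ • ξ⟫_ℝ = ⟪x, ξ⟫_ℝ + ⟪z - y, l⁻¹ • ξ⟫_ℝ := by
    rw [show z + l • x - y = (z - y) + l • x by abel, inner_add_left, real_inner_smul_left,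
      real_inner_smul_right (x := x), mul_inv_cancel_left₀ hl.ne', add_comm]
  rw [h3, Complex.ofReal_add, mul_add, Complex.exp_add]
  ring

theorem norm_iteratedFDeriv_const_mul_comp_add_smul {n : ℕ} {g : Rn n → ℂ}
    (hg : ContDiff ℝ (⊤ : ℕ∞) g) (c : ℂ) (z : Rn n) {l : ℝ} (hl : 0 ≤ l) (p : ℕ) (x : Rn n) :
    ‖iteratedFDeriv ℝ p (fun x => c * g (z + l • x)) x‖ =
      ‖c‖ * (l ^ p * ‖iteratedFDeriv ℝ p g (z + l • x)‖) := by
  have hg' : ContDiff ℝ p fun w => g (z + w) :=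
    (hg.comp (contDiff_const.add contDiff_id)).of_le (by exact_mod_cast le_top)
  have h1 : ContDiff ℝ p fun x => g (z + l • x) :=
    hg'.comp (g := fun w => g (z + w)) (contDiff_const_smul l)
  have h2 := iteratedFDeriv_const_smul_apply' (a := c) h1.contDiffAt (x := x)
  simp only [smul_eq_mul] at h2
  rw [h2, norm_smul, congrFun (iteratedFDeriv_comp_const_smul l hg') x, norm_smul,
    iteratedFDeriv_comp_add_left, norm_pow, Real.norm_of_nonneg hl]

theorem dilated_symbol_weight_le {n p : ℕ} {δ l t : ℝ} (hδ0 : 0 ≤ δ) (hδ1 : δ < 1) (hl : 0 < l)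
    (hl1 : l ≤ 1) (ht : 0 ≤ t) (h : l⁻¹ ≤ 1 + l⁻¹ * t) :
    l⁻¹ ^ n * (l ^ p * (((1 + l⁻¹ * t) ^ n)⁻¹ * ((1 + l⁻¹ * t) ^ δ) ^ p)) ≤
      2 ^ n * ((1 + t) ^ n)⁻¹ * ((1 + t) ^ δ) ^ p := by
  have hL : 1 ≤ l⁻¹ := (one_le_inv₀ hl).2 hl1
  have h1 : l⁻¹ ^ n * ((1 + l⁻¹ * t) ^ n)⁻¹ ≤ 2 ^ n * ((1 + t) ^ n)⁻¹ := by
    rw [← div_eq_mul_inv, ← div_eq_mul_inv, ← div_pow, ← div_pow]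
    have : l⁻¹ / (1 + l⁻¹ * t) ≤ 2 / (1 + t) := by
      rw [div_le_div_iff₀ (by positivity) (by positivity)]
      nlinarith
    gcongr
  have h2 : l ^ p * ((1 + l⁻¹ * t) ^ δ) ^ p ≤ ((1 + t) ^ δ) ^ p := by
    rw [← mul_pow]
    have h3 : (1 + l⁻¹ * t) ^ δ ≤ l⁻¹ * (1 + t) ^ δ := by
      calc (1 + l⁻¹ * t) ^ δ ≤ (l⁻¹ * (1 + t)) ^ δ := by
            gcongr
            linarith
        _ = l⁻¹ ^ δ * (1 + t) ^ δ := mul_rpow (by positivity) (by positivity)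
        _ ≤ l⁻¹ ^ (1 : ℝ) * (1 + t) ^ δ := by
            gcongr
        _ = _ := by rw [rpow_one]
    have h4 : l * (1 + l⁻¹ * t) ^ δ ≤ (1 + t) ^ δ := by
      calc _ ≤ l * (l⁻¹ * (1 + t) ^ δ) := by gcongr
        _ = _ := mul_inv_cancel_left₀ hl.ne' _
    gcongr
  calc _ = (l⁻¹ ^ n * ((1 + l⁻¹ * t) ^ n)⁻¹) * (l ^ p * ((1 + l⁻¹ * t) ^ δ) ^ p) := by ring
    _ ≤ _ := by gcongr

theorem exists_lintegral_cube_oscKernel_sq_le {n : ℕ} (hn : 1 ≤ n) {δ : ℝ} (hδ0 : 0 ≤ δ)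
    (hδ1 : δ < 1) {b : Rn n → Rn n → ℂ} (hb : HormClass (-(n : ℝ)) 0 δ b) :
    ∃ C : ℝ, 0 ≤ C ∧ ∀ (H l : ℝ) (z y : Rn n) (θ : Rn n → ℂ), 0 ≤ H → 0 < l → l ≤ 1 →
      Continuous θ → HasCompactSupport θ → (∀ ξ, ‖θ ξ‖ ≤ H) →
      (∀ ξ, 1 + ‖ξ‖ < l⁻¹ → θ ξ = 0) →
      ∫⁻ x in cube z l, ‖oscKernel b θ x y‖ₑ ^ 2 ≤ ENNReal.ofReal (C * H ^ 2 * l ^ n) := by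
  obtain ⟨N, C₀, hC₀, key⟩ := exists_lintegral_unit_cube_sq_le hn hδ0 hδ1
  obtain ⟨D, hD, hbD⟩ := hb.exists_norm_iteratedFDeriv_le hδ0 N
  refine ⟨C₀ * (D * 2 ^ n) ^ 2, by positivity, ?_⟩
  intro H l z y θ hH hl hl1 hθ hθc hθH hθ0
  rw [lintegral_cube_eq_lintegral_unit_cube _ z hl]
  simp_rw [oscKernel_add_smul b θ z y _ hl]
  have hbc : Continuous (Function.uncurry b) := hb.1.continuous
  have := key (H * (D * 2 ^ n)) (fun x ξ => (((l⁻¹ ^ n : ℝ) : ℂ) *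
      (Complex.exp (Complex.I * ((⟪z - y, l⁻¹ • ξ⟫_ℝ : ℝ) : ℂ)) * θ (l⁻¹ • ξ))) *
      b (z + l • x) (l⁻¹ • ξ)) ((fun ξ => l • ξ) '' tsupport θ) (by positivity)
    (hθc.isCompact.image (continuous_const_smul l)) ?_ ?_ ?_ ?_
  · calc _ ≤ ENNReal.ofReal (l ^ n) * ENNReal.ofReal (C₀ * (H * (D * 2 ^ n)) ^ 2) := by gcongr
      _ = _ := by
        rw [← ENNReal.ofReal_mul (by positivity)]
        congr 1
        ring
  · refine Continuous.mul (continuous_const.mul (Continuous.mul ?_ ?_)) ?_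
    · fun_prop
    · fun_prop
    · exact hbc.comp (g := Function.uncurry b)
        (f := fun p : Rn n × Rn n => (z + l • p.1, l⁻¹ • p.2)) (by fun_prop)
  · intro ξ hξ x
    have : θ (l⁻¹ • ξ) = 0 := image_eq_zero_of_notMem_tsupport fun h =>
      hξ ⟨l⁻¹ • ξ, h, smul_inv_smul₀ hl.ne' ξ⟩
    rw [this]
    simp
  · intro ξ
    exact contDiff_const.mul ((contDiff_slice_left hb.1 (l⁻¹ • ξ)).comp
      (contDiff_const.add (contDiff_const_smul l)))
  · intro p hp x ξ
    rw [norm_iteratedFDeriv_const_mul_comp_add_smul (contDiff_slice_left hb.1 (l⁻¹ • ξ)) _ z hl.le,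
      norm_mul, norm_mul, mul_comm Complex.I, Complex.norm_exp_ofReal_mul_I, one_mul,
      Complex.norm_real, Real.norm_of_nonneg (by positivity)]
    by_cases h : 1 + ‖l⁻¹ • ξ‖ < l⁻¹
    · rw [hθ0 _ h]
      simp only [norm_zero, mul_zero, zero_mul]
      positivity
    · have hd := hbD p hp (z + l • x) (l⁻¹ • ξ)
      have hns : ‖l⁻¹ • ξ‖ = l⁻¹ * ‖ξ‖ := by
        rw [norm_smul, Real.norm_of_nonneg (by positivity)]
      rw [hns] at hd h
      have hw := dilated_symbol_weight_le (n := n) (p := p) hδ0 hδ1 hl hl1 (norm_nonneg ξ)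
        (not_lt.1 h)
      calc l⁻¹ ^ n * ‖θ (l⁻¹ • ξ)‖ *
            (l ^ p * ‖iteratedFDeriv ℝ p (fun x => b x (l⁻¹ • ξ)) (z + l • x)‖)
          ≤ l⁻¹ ^ n * H * (l ^ p * (D * ((1 + l⁻¹ * ‖ξ‖) ^ n)⁻¹ *
              ((1 + l⁻¹ * ‖ξ‖) ^ δ) ^ p)) := by
            gcongr
            exact hθH _
        _ = H * D * (l⁻¹ ^ n * (l ^ p * (((1 + l⁻¹ * ‖ξ‖) ^ n)⁻¹ *
              ((1 + l⁻¹ * ‖ξ‖) ^ δ) ^ p))) := by ring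
        _ ≤ H * D * (2 ^ n * ((1 + ‖ξ‖) ^ n)⁻¹ * ((1 + ‖ξ‖) ^ δ) ^ p) := by gcongr
        _ = _ := by ring

theorem measurable_oscKernel {n : ℕ} {b : Rn n → Rn n → ℂ} {θ : Rn n → ℂ}
    (hb : Continuous (Function.uncurry b)) (hθ : Continuous θ) :
    Measurable fun p : Rn n × Rn n => oscKernel b θ p.1 p.2 := by
  have h : Continuous fun q : (Rn n × Rn n) × Rn n =>
      Complex.exp (Complex.I * ((⟪q.1.1 - q.1.2, q.2⟫_ℝ : ℝ) : ℂ)) * (b q.1.1 q.2 * θ q.2) := by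
    refine Continuous.mul (by fun_prop) (Continuous.mul ?_ (hθ.comp continuous_snd))
    exact hb.comp (g := Function.uncurry b)
      (f := fun q : (Rn n × Rn n) × Rn n => (q.1.1, q.2)) (by fun_prop)
  exact (StronglyMeasurable.integral_prod_right (ν := (volume : Measure (Rn n)))
    (f := fun (p : Rn n × Rn n) ξ =>
      Complex.exp (Complex.I * ((⟪p.1 - p.2, ξ⟫_ℝ : ℝ) : ℂ)) * (b p.1 ξ * θ ξ))
    h.measurable.stronglyMeasurable).measurable

theorem measurable_oscKernel_left {n : ℕ} {b : Rn n → Rn n → ℂ} {θ : Rn n → ℂ}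
    (hb : Continuous (Function.uncurry b)) (hθ : Continuous θ) (y : Rn n) :
    Measurable fun x => oscKernel b θ x y := by
  have h : Continuous fun q : Rn n × Rn n =>
      Complex.exp (Complex.I * ((⟪q.1 - y, q.2⟫_ℝ : ℝ) : ℂ)) * (b q.1 q.2 * θ q.2) :=
    Continuous.mul (by fun_prop) (Continuous.mul hb (hθ.comp continuous_snd))
  exact (StronglyMeasurable.integral_prod_right (ν := (volume : Measure (Rn n)))
    (f := fun x ξ => Complex.exp (Complex.I * ((⟪x - y, ξ⟫_ℝ : ℝ) : ℂ)) * (b x ξ * θ ξ))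
    h.measurable.stronglyMeasurable).measurable

theorem hasFDerivAt_exp_inner {n : ℕ} (w ξ : Rn n) :
    HasFDerivAt (fun ξ : Rn n => Complex.exp (Complex.I * ((⟪w, ξ⟫_ℝ : ℝ) : ℂ)))
      ((Complex.exp (Complex.I * ((⟪w, ξ⟫_ℝ : ℝ) : ℂ)) * Complex.I) •
        Complex.ofRealCLM.comp (innerSL ℝ w)) ξ := by
  have h1 : HasFDerivAt (fun ξ : Rn n => ((⟪w, ξ⟫_ℝ : ℝ) : ℂ))
      (Complex.ofRealCLM.comp (innerSL ℝ w)) ξ :=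
    (Complex.ofRealCLM.comp (innerSL ℝ w)).hasFDerivAt
  have h2 := (h1.const_mul Complex.I).cexp
  rwa [smul_smul] at h2

theorem inner_mul_oscKernel {n : ℕ} {b : Rn n → Rn n → ℂ} {θ : Rn n → ℂ}
    (hb : ContDiff ℝ (⊤ : ℕ∞) (Function.uncurry b)) (hθ : ContDiff ℝ (⊤ : ℕ∞) θ)
    (hθc : HasCompactSupport θ) (v x y : Rn n) :
    ((⟪x - y, v⟫_ℝ : ℝ) : ℂ) * oscKernel b θ x y =
      Complex.I * (oscKernel (fun x ξ => fderiv ℝ (b x) ξ v) θ x y +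
        oscKernel b (fun ξ => fderiv ℝ θ ξ v) x y) := by
  set e : Rn n → ℂ := fun ξ => Complex.exp (Complex.I * ((⟪x - y, ξ⟫_ℝ : ℝ) : ℂ)) with he
  have hec : Continuous e := by rw [he]; fun_prop
  have hbx := contDiff_slice_right hb x
  have hd : ∀ f : Rn n → ℂ, ContDiff ℝ (⊤ : ℕ∞) f → Continuous fun ξ => fderiv ℝ f ξ v :=
    fun f hf => (hf.continuous_fderiv (by simp)).clm_apply continuous_const
  have hdθc : HasCompactSupport fun ξ => fderiv ℝ θ ξ v := hθc.fderiv_apply ℝ v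
  have hdiff : ∀ ξ, fderiv ℝ (fun ξ => b x ξ * θ ξ) ξ v =
      fderiv ℝ (b x) ξ v * θ ξ + b x ξ * fderiv ℝ θ ξ v := fun ξ => by
    rw [fderiv_fun_mul (hbx.differentiable (by simp) ξ) (hθ.differentiable (by simp) ξ)]
    simp only [add_apply, FunLike.coe_smul, Pi.smul_apply, smul_eq_mul]
    ring
  have hde : ∀ ξ, fderiv ℝ e ξ v = e ξ * Complex.I * ((⟪x - y, v⟫_ℝ : ℝ) : ℂ) := fun ξ => by
    rw [he, (hasFDerivAt_exp_inner (x - y) ξ).fderiv]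
    simp [inner_sub_left]
  have hInt : ∀ f g : Rn n → ℂ, Continuous f → Continuous g → HasCompactSupport g →
      Integrable (fun ξ => e ξ * (f ξ * g ξ)) := fun f g hf hg hgc =>
    (hec.mul (hf.mul hg)).integrable_of_hasCompactSupport (hgc.mul_left.mul_left)
  have i1 := hInt _ _ (hd _ hbx) hθ.continuous hθc
  have i2 := hInt _ _ hbx.continuous (hd _ hθ) hdθc
  have i3 := hInt _ _ hbx.continuous hθ.continuous hθc
  have ibp := integral_mul_fderiv_eq_neg_fderiv_mul_of_integrable (μ := (volume : Measure (Rn n)))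
    (f := e) (g := fun ξ => b x ξ * θ ξ) (v := v) ?_ ?_ i3
    (fun ξ _ => (hasFDerivAt_exp_inner (x - y) ξ).differentiableAt)
    (fun ξ _ => (hbx.mul hθ).differentiable (by simp) ξ)
  · simp_rw [hdiff, hde, mul_add] at ibp
    rw [integral_add i1 i2] at ibp
    have h4 : ∫ ξ, e ξ * Complex.I * ((⟪x - y, v⟫_ℝ : ℝ) : ℂ) * (b x ξ * θ ξ) =
        Complex.I * ((⟪x - y, v⟫_ℝ : ℝ) : ℂ) * oscKernel b θ x y := by
      rw [oscKernel, ← integral_const_mul]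
      congr 1
      funext ξ
      simp only [he]
      ring
    rw [h4] at ibp
    change oscKernel (fun x ξ => fderiv ℝ (b x) ξ v) θ x y +
        oscKernel b (fun ξ => fderiv ℝ θ ξ v) x y = _ at ibp
    rw [ibp]
    ring_nf
    rw [Complex.I_sq]
    ring
  · simp_rw [hde]
    refine ((i3.const_mul (Complex.I * ((⟪x - y, v⟫_ℝ : ℝ) : ℂ)))).congr
      (Filter.Eventually.of_forall fun ξ => ?_)
    simp only
    ring
  · simp_rw [hdiff, mul_add]
    exact i1.add i2

theorem enorm_add_sq_le (a b : ℂ) : ‖a + b‖ₑ ^ 2 ≤ 4 * (‖a‖ₑ ^ 2 + ‖b‖ₑ ^ 2) := by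
  have h : ∀ s t : ℝ≥0∞, s ≤ t → (s + t) ^ 2 ≤ 4 * (s ^ 2 + t ^ 2) := fun s t hst => by
    calc (s + t) ^ 2 ≤ (t + t) ^ 2 := by gcongr
      _ = 4 * t ^ 2 := by ring
      _ ≤ _ := by gcongr; exact le_add_self
  refine (pow_le_pow_left' (enorm_add_le a b) 2).trans ?_
  rcases le_total ‖a‖ₑ ‖b‖ₑ with hab | hab
  · exact h _ _ hab
  · rw [add_comm, add_comm (‖a‖ₑ ^ 2)]
    exact h _ _ hab

theorem exists_lintegral_cube_inner_pow_mul_oscKernel_sq_le {n : ℕ} (hn : 1 ≤ n) {δ : ℝ}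
    (hδ0 : 0 ≤ δ) (hδ1 : δ < 1) {v : Rn n} (hv : ‖v‖ ≤ 1) {H : ℝ} (hH : 0 ≤ H) (M : ℕ) :
    ∀ b : Rn n → Rn n → ℂ, HormClass (-(n : ℝ)) 0 δ b →
    ∃ C : ℝ, 0 ≤ C ∧ ∀ (l : ℝ) (z y : Rn n) (θ : Rn n → ℂ), 0 < l → l ≤ 1 →
      ContDiff ℝ (⊤ : ℕ∞) θ → HasCompactSupport θ →
      (∀ p ≤ M, ∀ ξ, ‖iteratedFDeriv ℝ p θ ξ‖ ≤ H) → (∀ ξ, 1 + ‖ξ‖ < l⁻¹ → θ ξ = 0) →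
      ∫⁻ x in cube z l, ‖((⟪x - y, v⟫_ℝ : ℝ) : ℂ) ^ M * oscKernel b θ x y‖ₑ ^ 2 ≤
        ENNReal.ofReal (C * l ^ n) := by
  induction M with
  | zero =>
    intro b hb
    obtain ⟨C, hC, h⟩ := exists_lintegral_cube_oscKernel_sq_le hn hδ0 hδ1 hb
    refine ⟨C * H ^ 2, by positivity, fun l z y θ hl hl1 hθ hθc hθH hθ0 => ?_⟩
    simp only [pow_zero, one_mul]
    exact h H l z y θ hH hl hl1 hθ.continuous hθc
      (fun ξ => (norm_iteratedFDeriv_zero (𝕜 := ℝ) (f := θ) (x := ξ)).symm.trans_le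
        (hθH 0 le_rfl ξ)) hθ0
  | succ M ih =>
    intro b hb
    obtain ⟨C₁, hC₁, h₁⟩ := ih _ (hb.fderiv_apply v)
    obtain ⟨C₂, hC₂, h₂⟩ := ih b hb
    refine ⟨4 * (C₁ + C₂), by positivity, fun l z y θ hl hl1 hθ hθc hθH hθ0 => ?_⟩
    have hdθ : ContDiff ℝ (⊤ : ℕ∞) fun ξ => fderiv ℝ θ ξ v :=
      (hθ.fderiv_right (by norm_cast)).clm_apply contDiff_const
    have e1 := h₁ l z y θ hl hl1 hθ hθc (fun p hp => hθH p (by omega)) hθ0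
    have e2 := h₂ l z y (fun ξ => fderiv ℝ θ ξ v) hl hl1 hdθ (hθc.fderiv_apply ℝ v)
      (fun p hp ξ => by
        refine (norm_iteratedFDeriv_fderiv_apply_le hθ v p ξ).trans ?_
        calc _ ≤ 1 * H := by
              gcongr
              exact hθH _ (by omega) ξ
          _ = H := one_mul H)
      (fun ξ hξ => by
        have : θ =ᶠ[nhds ξ] fun _ => 0 := by
          filter_upwards [(isOpen_lt (by fun_prop) continuous_const :
            IsOpen {ξ : Rn n | 1 + ‖ξ‖ < l⁻¹}).mem_nhds hξ] with η hη using hθ0 η hη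
        rw [this.fderiv_eq]
        simp)
    have hm : Measurable fun x => ‖((⟪x - y, v⟫_ℝ : ℝ) : ℂ) ^ M *
        oscKernel (fun x ξ => fderiv ℝ (b x) ξ v) θ x y‖ₑ ^ 2 := by
      have := measurable_oscKernel_left (hb.fderiv_apply v).1.continuous hθ.continuous y
      have h2 : Measurable fun x : Rn n => ((⟪x - y, v⟫_ℝ : ℝ) : ℂ) ^ M :=
        Continuous.measurable (by fun_prop)
      exact (h2.mul this).enorm.pow_const 2
    calc _ ≤ ∫⁻ x in cube z l, 4 * (‖((⟪x - y, v⟫_ℝ : ℝ) : ℂ) ^ M *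
            oscKernel (fun x ξ => fderiv ℝ (b x) ξ v) θ x y‖ₑ ^ 2 +
          ‖((⟪x - y, v⟫_ℝ : ℝ) : ℂ) ^ M * oscKernel b (fun ξ => fderiv ℝ θ ξ v) x y‖ₑ ^ 2) := by
          refine lintegral_mono fun x => ?_
          rw [pow_succ (((⟪x - y, v⟫_ℝ : ℝ) : ℂ)) M, mul_assoc,
            inner_mul_oscKernel hb.1 hθ hθc, mul_left_comm, mul_add,
            enorm_mul, show ‖Complex.I‖ₑ = 1 by simp [enorm_eq_nnnorm], one_mul]
          exact enorm_add_sq_le _ _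
      _ ≤ 4 * (ENNReal.ofReal (C₁ * l ^ n) + ENNReal.ofReal (C₂ * l ^ n)) := by
          rw [lintegral_const_mul' _ _ (by simp), lintegral_add_left hm]
          gcongr
      _ = ENNReal.ofReal (4 * (C₁ + C₂) * l ^ n) := by
          rw [← ENNReal.ofReal_add (by positivity) (by positivity), mul_assoc, add_mul,
            ENNReal.ofReal_mul (p := 4) (by norm_num)]
          simp

theorem norm_pow_le_sum_pow {n : ℕ} (hn : 1 ≤ n) (v : Rn n) (M : ℕ) :
    ‖v‖ ^ M ≤ (2 * n) ^ M * ∑ i, |v i| ^ M := by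
  have : Nonempty (Fin n) := ⟨⟨0, hn⟩⟩
  obtain ⟨i, -, hi⟩ := Finset.exists_max_image Finset.univ (fun i => |v i|) Finset.univ_nonempty
  have h1 : ‖v‖ ≤ 2 * n * |v i| := by
    have := norm_sub_le_of_mem_cube (x := v) (z := 0) (l := 2 * |v i|) (fun j => by
      simpa using hi j (Finset.mem_univ j))
    rw [sub_zero] at this
    linarith
  calc ‖v‖ ^ M ≤ (2 * n * |v i|) ^ M := by gcongr
    _ = (2 * n) ^ M * |v i| ^ M := mul_pow _ _ _
    _ ≤ _ := by
      gcongr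
      exact Finset.single_le_sum (f := fun i => |v i| ^ M) (fun j _ => by positivity)
        (Finset.mem_univ i)

theorem weight_le_of_mem_cube {n : ℕ} (hn : 1 ≤ n) (M : ℕ) {l : ℝ} (hl1 : l ≤ 1) {z x : Rn n}
    (hx : x ∈ cube z l) (y : Rn n) :
    (1 + ‖z - y‖) ^ M ≤ ((1 + n) * 2) ^ M * (1 + (2 * n) ^ M * ∑ i, |(x - y) i| ^ M) := by
  have h1 : ‖z - x‖ ≤ n := by
    rw [norm_sub_rev]
    have : (n : ℝ) * l ≤ n := mul_le_of_le_one_right n.cast_nonneg hl1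
    exact (norm_sub_le_of_mem_cube hx).trans this
  have h2 : 1 + ‖z - y‖ ≤ (1 + n) * (1 + ‖x - y‖) := by
    have h3 : ‖z - y‖ ≤ ‖z - x‖ + ‖x - y‖ := norm_sub_le_norm_sub_add_norm_sub z x y
    have h4 : 0 ≤ (n : ℝ) * ‖x - y‖ := by positivity
    nlinarith
  calc (1 + ‖z - y‖) ^ M ≤ ((1 + n) * (1 + ‖x - y‖)) ^ M := by gcongr
    _ = (1 + n) ^ M * (1 + ‖x - y‖) ^ M := mul_pow _ _ _
    _ ≤ (1 + n) ^ M * (2 ^ M * (1 + ‖x - y‖ ^ M)) := by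
      gcongr
      exact one_add_pow_le (norm_nonneg _) M
    _ ≤ (1 + n) ^ M * (2 ^ M * (1 + (2 * n) ^ M * ∑ i, |(x - y) i| ^ M)) := by
      gcongr
      exact norm_pow_le_sum_pow hn _ M
    _ = _ := by rw [mul_pow (1 + (n : ℝ)) 2 M]; ring

theorem enorm_le_one_add_sq (a : ℂ) : ‖a‖ₑ ≤ 1 + ‖a‖ₑ ^ 2 := by
  rcases le_total ‖a‖ₑ 1 with h | h
  · exact h.trans le_self_add
  · calc ‖a‖ₑ = ‖a‖ₑ * 1 := (mul_one _).symm
      _ ≤ ‖a‖ₑ ^ 2 := by rw [sq]; gcongr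
      _ ≤ _ := le_add_self

/-- Averaged off-diagonal decay of the kernel of the part of a pseudo-differential operator whose
frequencies are at least the inverse side length of the cube. -/
theorem exists_lintegral_cube_oscKernel_le {n : ℕ} (hn : 1 ≤ n) {δ : ℝ}
    (hδ0 : 0 ≤ δ) (hδ1 : δ < 1) {H : ℝ} (hH : 0 ≤ H) (M : ℕ)
    {b : Rn n → Rn n → ℂ} (hb : HormClass (-(n : ℝ)) 0 δ b) :
    ∃ C : ℝ, 0 ≤ C ∧ ∀ (l : ℝ) (z y : Rn n) (θ : Rn n → ℂ), 0 < l → l ≤ 1 →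
      ContDiff ℝ (⊤ : ℕ∞) θ → HasCompactSupport θ →
      (∀ p ≤ M, ∀ ξ, ‖iteratedFDeriv ℝ p θ ξ‖ ≤ H) → (∀ ξ, 1 + ‖ξ‖ < l⁻¹ → θ ξ = 0) →
      ∫⁻ x in cube z l, ‖oscKernel b θ x y‖ₑ ≤
        ENNReal.ofReal (C * l ^ n) * ENNReal.ofReal (((1 + ‖z - y‖) ^ M)⁻¹) := by
  obtain ⟨C₀, hC₀, h₀⟩ := exists_lintegral_cube_oscKernel_sq_le hn hδ0 hδ1 hb
  have hi : ∀ i : Fin n, ‖(EuclideanSpace.single i (1 : ℝ) : Rn n)‖ ≤ 1 := fun i => by simp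
  choose C₁ hC₁ h₁ using fun i =>
    exists_lintegral_cube_inner_pow_mul_oscKernel_sq_le hn hδ0 hδ1 (hi i) hH M b hb
  set c : ℝ := ((1 + n) * 2) ^ M with hc
  set d : ℝ := (2 * n) ^ M with hd
  have hs : 0 ≤ ∑ i, (1 + C₁ i) := Finset.sum_nonneg fun i _ => by linarith [hC₁ i]
  refine ⟨c * ((1 + C₀ * H ^ 2) + d * ∑ i, (1 + C₁ i)), by positivity,
    fun l z y θ hl hl1 hθ hθc hθH hθ0 => ?_⟩
  have e0 := h₀ H l z y θ hH hl hl1 hθ.continuous hθc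
      (fun ξ => (norm_iteratedFDeriv_zero (𝕜 := ℝ) (f := θ) (x := ξ)).symm.trans_le
        (hθH 0 (Nat.zero_le _) ξ)) hθ0
  have e1 := fun i => h₁ i l z y θ hl hl1 hθ hθc hθH hθ0
  set k : Rn n → ℂ := fun x => oscKernel b θ x y with hk
  have hkm : Measurable k :=
    measurable_oscKernel_left hb.1.continuous hθ.continuous y
  set W : ℝ := (1 + ‖z - y‖) ^ M with hW
  have hW0 : 0 < W := by positivity
  set q : Fin n → Rn n → ℂ := fun i x =>
    ((⟪x - y, EuclideanSpace.single i (1 : ℝ)⟫_ℝ : ℝ) : ℂ) ^ M * k x with hq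
  have hqm : ∀ i, Measurable (q i) := fun i =>
    (Continuous.measurable (by fun_prop)).mul hkm
  have hqn : ∀ i x, ‖q i x‖ = |(x - y) i| ^ M * ‖k x‖ := fun i x => by
    simp only [hq]
    rw [norm_mul, norm_pow, Complex.norm_real, EuclideanSpace.inner_single_right, Real.norm_eq_abs]
    simp
  have hpt : ∀ x ∈ cube z l, ENNReal.ofReal W * ‖k x‖ₑ ≤
      ENNReal.ofReal c * ((1 + ‖k x‖ₑ ^ 2) + ENNReal.ofReal d * ∑ i, (1 + ‖q i x‖ₑ ^ 2)) := by
    intro x hx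
    calc ENNReal.ofReal W * ‖k x‖ₑ
        = ENNReal.ofReal (W * ‖k x‖) := by
          rw [ENNReal.ofReal_mul hW0.le, ofReal_norm]
      _ ≤ ENNReal.ofReal (c * (‖k x‖ + d * ∑ i, ‖q i x‖)) := by
          refine ENNReal.ofReal_le_ofReal ?_
          simp_rw [hqn, ← Finset.sum_mul]
          calc W * ‖k x‖ ≤ c * (1 + d * ∑ i, |(x - y) i| ^ M) * ‖k x‖ := by
                gcongr
                exact weight_le_of_mem_cube hn M hl1 hx y
            _ = _ := by ring
      _ = ENNReal.ofReal c * (‖k x‖ₑ + ENNReal.ofReal d * ∑ i, ‖q i x‖ₑ) := by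
          rw [ENNReal.ofReal_mul (by positivity), ENNReal.ofReal_add (by positivity)
            (by positivity), ENNReal.ofReal_mul (by positivity),
            ENNReal.ofReal_sum_of_nonneg fun i _ => norm_nonneg _]
          simp_rw [ofReal_norm]
      _ ≤ _ := by
          gcongr
          · exact enorm_le_one_add_sq _
          · exact enorm_le_one_add_sq _
  have hvol : ∫⁻ _ in cube z l, (1 : ℝ≥0∞) = ENNReal.ofReal (l ^ n) := by
    rw [setLIntegral_one, volume_cube z hl.le]
  have hadd : ∀ (g : Rn n → ℂ) (D : ℝ), 0 ≤ D →
      ∫⁻ x in cube z l, ‖g x‖ₑ ^ 2 ≤ ENNReal.ofReal (D * l ^ n) →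
      ∫⁻ x in cube z l, (1 + ‖g x‖ₑ ^ 2) ≤ ENNReal.ofReal ((1 + D) * l ^ n) := by
    intro g D hD h
    rw [lintegral_add_left measurable_const, hvol, add_mul, one_mul,
      ENNReal.ofReal_add (by positivity) (by positivity)]
    gcongr
  have h1m : ∀ {g : Rn n → ℂ}, Measurable g → Measurable fun x => 1 + ‖g x‖ₑ ^ 2 :=
    fun hg => (hg.enorm.pow_const 2).const_add 1
  have hmain : ∫⁻ x in cube z l, ENNReal.ofReal W * ‖k x‖ₑ ≤
      ENNReal.ofReal (c * ((1 + C₀ * H ^ 2) + d * ∑ i, (1 + C₁ i)) * l ^ n) := by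
    calc _ ≤ ∫⁻ x in cube z l, ENNReal.ofReal c *
            ((1 + ‖k x‖ₑ ^ 2) + ENNReal.ofReal d * ∑ i, (1 + ‖q i x‖ₑ ^ 2)) :=
          setLIntegral_mono' (measurableSet_cube z l) hpt
      _ = ENNReal.ofReal c * ((∫⁻ x in cube z l, (1 + ‖k x‖ₑ ^ 2)) +
            ENNReal.ofReal d * ∑ i, ∫⁻ x in cube z l, (1 + ‖q i x‖ₑ ^ 2)) := by
          rw [lintegral_const_mul' _ _ ENNReal.ofReal_ne_top, lintegral_add_left
            (h1m hkm), lintegral_const_mul' _ _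
            ENNReal.ofReal_ne_top, lintegral_finsetSum _ fun i _ =>
            h1m (hqm i)]
      _ ≤ ENNReal.ofReal c * (ENNReal.ofReal ((1 + C₀ * H ^ 2) * l ^ n) +
            ENNReal.ofReal d * ∑ i, ENNReal.ofReal ((1 + C₁ i) * l ^ n)) := by
          gcongr with i
          · exact hadd k _ (by positivity) e0
          · exact hadd (q i) _ (hC₁ i) (e1 i)
      _ = _ := by
          have hnn : ∀ i ∈ Finset.univ, 0 ≤ (1 + C₁ i) * l ^ n := fun i _ =>
            mul_nonneg (by linarith [hC₁ i]) (by positivity)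
          rw [← ENNReal.ofReal_sum_of_nonneg hnn, ← ENNReal.ofReal_mul (by positivity),
            ← ENNReal.ofReal_add (by positivity) (mul_nonneg (by positivity)
              (Finset.sum_nonneg hnn)), ← ENNReal.ofReal_mul (by positivity), ← Finset.sum_mul]
          congr 1
          ring
  rw [lintegral_const_mul' _ _ ENNReal.ofReal_ne_top] at hmain
  calc ∫⁻ x in cube z l, ‖k x‖ₑ
      = ENNReal.ofReal W⁻¹ * (ENNReal.ofReal W * ∫⁻ x in cube z l, ‖k x‖ₑ) := by
        rw [← mul_assoc, ← ENNReal.ofReal_mul (by positivity), inv_mul_cancel₀ hW0.ne',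
          ENNReal.ofReal_one, one_mul]
    _ ≤ ENNReal.ofReal W⁻¹ * _ := by gcongr
    _ = _ := mul_comm _ _

theorem integrable_prod_exp_inner_mul {n : ℕ} {g f : Rn n → ℂ} (hg : Continuous g)
    (hgc : HasCompactSupport g) (hf : Continuous f) (hfi : Integrable f) (x : Rn n) :
    Integrable (Function.uncurry fun ξ y : Rn n =>
      Complex.exp (Complex.I * ((⟪x - y, ξ⟫_ℝ : ℝ) : ℂ)) * g ξ * f y)
      (volume.prod volume) := by
  have hc : Continuous (Function.uncurry fun ξ y : Rn n =>
      Complex.exp (Complex.I * ((⟪x - y, ξ⟫_ℝ : ℝ) : ℂ)) * g ξ * f y) := by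
    simp only [Function.uncurry_def]
    fun_prop
  refine ((hg.integrable_of_hasCompactSupport hgc).mul_prod hfi).mono hc.aestronglyMeasurable
    (Filter.Eventually.of_forall fun p => ?_)
  simp only [Function.uncurry_def]
  rw [norm_mul, norm_mul, mul_comm Complex.I, Complex.norm_exp_ofReal_mul_I, one_mul, norm_mul]

theorem integrable_oscKernel_mul {n : ℕ} {b : Rn n → Rn n → ℂ} {θ f : Rn n → ℂ}
    {x : Rn n} (hb : Continuous (b x)) (hθ : Continuous θ) (hθc : HasCompactSupport θ)
    (hf : Continuous f) (hfi : Integrable f) :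
    Integrable fun y => oscKernel b θ x y * f y := by
  refine (integrable_prod_exp_inner_mul (hb.mul hθ) hθc.mul_left hf hfi x).integral_prod_right.congr
    (Filter.Eventually.of_forall fun y => ?_)
  simp only [Function.uncurry_apply_pair, oscKernel]
  exact integral_mul_const _ _

theorem pdo_mul_eq_integral_oscKernel {n : ℕ} {b : Rn n → Rn n → ℂ} {θ f : Rn n → ℂ}
    {x : Rn n} (hb : Continuous (b x)) (hθ : Continuous θ) (hθc : HasCompactSupport θ)
    (hf : Continuous f) (hfi : Integrable f) :
    pdo (fun x ξ => b x ξ * θ ξ) f x = ∫ y, oscKernel b θ x y * f y := by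
  calc pdo (fun x ξ => b x ξ * θ ξ) f x
      = ∫ ξ, ∫ y, Complex.exp (Complex.I * ((⟪x - y, ξ⟫_ℝ : ℝ) : ℂ)) * (b x ξ * θ ξ) * f y := by
        simp only [pdo, ft]
        congr 1
        funext ξ
        rw [← integral_const_mul]
        congr 1
        funext y
        rw [inner_sub_left, Complex.ofReal_sub, mul_sub, sub_eq_add_neg, Complex.exp_add]
        ring
    _ = ∫ y, ∫ ξ, Complex.exp (Complex.I * ((⟪x - y, ξ⟫_ℝ : ℝ) : ℂ)) * (b x ξ * θ ξ) * f y :=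
        integral_integral_swap
          (integrable_prod_exp_inner_mul (hb.mul hθ) hθc.mul_left hf hfi x)
    _ = _ := by
        congr 1
        funext y
        exact integral_mul_const _ _

theorem exists_lintegral_cube_pdo_mul_le {n : ℕ} (hn : 1 ≤ n) {δ : ℝ}
    (hδ0 : 0 ≤ δ) (hδ1 : δ < 1) {H : ℝ} (hH : 0 ≤ H) (M : ℕ)
    {b : Rn n → Rn n → ℂ} (hb : HormClass (-(n : ℝ)) 0 δ b) :
    ∃ C : ℝ, 0 ≤ C ∧ ∀ (l : ℝ) (z : Rn n) (θ f : Rn n → ℂ), 0 < l → l ≤ 1 →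
      ContDiff ℝ (⊤ : ℕ∞) θ → HasCompactSupport θ →
      (∀ p ≤ M, ∀ ξ, ‖iteratedFDeriv ℝ p θ ξ‖ ≤ H) → (∀ ξ, 1 + ‖ξ‖ < l⁻¹ → θ ξ = 0) →
      Continuous f → Integrable f →
      ∫⁻ x in cube z l, ‖pdo (fun x ξ => b x ξ * θ ξ) f x‖ₑ ≤
        ENNReal.ofReal (C * l ^ n) *
          ∫⁻ y, ‖f y‖ₑ * ENNReal.ofReal (((1 + ‖z - y‖) ^ M)⁻¹) := by
  obtain ⟨C, hC, h⟩ := exists_lintegral_cube_oscKernel_le hn hδ0 hδ1 hH M hb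
  refine ⟨C, hC, fun l z θ f hl hl1 hθ hθc hθH hθ0 hf hfi => ?_⟩
  have hm : Measurable fun p : Rn n × Rn n => ‖oscKernel b θ p.1 p.2 * f p.2‖ₑ :=
    ((measurable_oscKernel hb.1.continuous hθ.continuous).mul
      (hf.comp continuous_snd).measurable).enorm
  calc _ ≤ ∫⁻ x in cube z l, ∫⁻ y, ‖oscKernel b θ x y * f y‖ₑ := by
        refine lintegral_mono fun x => ?_
        rw [pdo_mul_eq_integral_oscKernel (contDiff_slice_right hb.1 x).continuous
          hθ.continuous hθc hf hfi]
        exact enorm_integral_le_lintegral_enorm _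
    _ = ∫⁻ y, ∫⁻ x in cube z l, ‖oscKernel b θ x y * f y‖ₑ :=
        lintegral_lintegral_swap hm.aemeasurable
    _ ≤ ∫⁻ y, ENNReal.ofReal (C * l ^ n) *
          (‖f y‖ₑ * ENNReal.ofReal (((1 + ‖z - y‖) ^ M)⁻¹)) := by
        refine lintegral_mono fun y => ?_
        simp_rw [enorm_mul]
        rw [lintegral_mul_const' _ _ (by simp)]
        calc _ ≤ ENNReal.ofReal (C * l ^ n) * ENNReal.ofReal (((1 + ‖z - y‖) ^ M)⁻¹) * ‖f y‖ₑ := by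
              gcongr
              exact h l z y θ hl hl1 hθ hθc hθH hθ0
          _ = _ := by ring
    _ = _ := lintegral_const_mul' _ _ ENNReal.ofReal_ne_top

theorem contDiff_exp_inner {n : ℕ} (v : Rn n) :
    ContDiff ℝ (⊤ : ℕ∞) fun ξ : Rn n => Complex.exp (Complex.I * ((⟪v, ξ⟫_ℝ : ℝ) : ℂ)) :=
  (contDiff_const.mul (Complex.ofRealCLM.contDiff.comp (innerSL ℝ v).contDiff)).cexp

theorem norm_iteratedFDeriv_exp_inner_le {n : ℕ} (v : Rn n) (p : ℕ) (ξ : Rn n) :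
    ‖iteratedFDeriv ℝ p (fun ξ : Rn n => Complex.exp (Complex.I * ((⟪v, ξ⟫_ℝ : ℝ) : ℂ))) ξ‖ ≤
      ‖v‖ ^ p := by
  induction p with
  | zero =>
    rw [norm_iteratedFDeriv_zero, mul_comm Complex.I, Complex.norm_exp_ofReal_mul_I, pow_zero]
  | succ p ih =>
    set L : Rn n →L[ℝ] ℂ := Complex.I • Complex.ofRealCLM.comp (innerSL ℝ v) with hL
    have hLn : ‖L‖ ≤ ‖v‖ := by
      refine L.opNorm_le_bound (norm_nonneg _) fun w => ?_
      simpa [hL] using abs_real_inner_le_norm v w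
    set T : ℂ →L[ℝ] (Rn n →L[ℝ] ℂ) := (ContinuousLinearMap.lsmul ℝ ℂ).flip L with hT
    have hTn : ‖T‖ ≤ ‖v‖ := by
      refine T.opNorm_le_bound (norm_nonneg _) fun c => ?_
      rw [hT, ContinuousLinearMap.flip_apply, ContinuousLinearMap.lsmul_apply, mul_comm]
      refine (norm_smul_le _ _).trans ?_
      gcongr
    have h : (fderiv ℝ fun ξ : Rn n => Complex.exp (Complex.I * ((⟪v, ξ⟫_ℝ : ℝ) : ℂ))) =
        T ∘ fun ξ : Rn n => Complex.exp (Complex.I * ((⟪v, ξ⟫_ℝ : ℝ) : ℂ)) := by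
      funext η
      rw [(hasFDerivAt_exp_inner v η).fderiv, Function.comp_apply, hT,
        ContinuousLinearMap.flip_apply, ContinuousLinearMap.lsmul_apply, hL, smul_smul]
    rw [← norm_iteratedFDeriv_fderiv, h]
    refine (T.norm_iteratedFDeriv_comp_left (contDiff_exp_inner v).contDiffAt
      (n := p) (by exact_mod_cast le_top)).trans ?_
    rw [pow_succ']
    gcongr

theorem norm_iteratedFDeriv_exp_inner_sub_one_le {n M : ℕ} {v : Rn n} {A l : ℝ} (hA : 1 ≤ A)
    (hl : 0 ≤ l) (hl1 : l ≤ 1) (hv : ‖v‖ ≤ A * l) {p : ℕ} (hp : p ≤ M) (ξ : Rn n) :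
    ‖iteratedFDeriv ℝ p
        (fun ξ : Rn n => Complex.exp (Complex.I * ((⟪v, ξ⟫_ℝ : ℝ) : ℂ)) - 1) ξ‖ ≤
      A ^ (M + 1) * l * (1 + ‖ξ‖) := by
  have hξ := norm_nonneg ξ
  rcases Nat.eq_zero_or_pos p with rfl | hp0
  · rw [norm_iteratedFDeriv_zero]
    calc _ ≤ ‖⟪v, ξ⟫_ℝ‖ := Real.norm_exp_I_mul_ofReal_sub_one_le
      _ ≤ ‖v‖ * ‖ξ‖ := norm_inner_le_norm _ _
      _ ≤ A * l * (1 + ‖ξ‖) := by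
        gcongr
        linarith
      _ ≤ _ := by
        gcongr
        exact le_self_pow₀ hA (by omega)
  · rw [fun_iteratedFDeriv_sub ((contDiff_exp_inner v).of_le (by exact_mod_cast le_top))
      contDiff_const, iteratedFDeriv_const_of_ne (by omega)]
    simp only [Pi.zero_apply, sub_zero]
    calc _ ≤ ‖v‖ ^ p := norm_iteratedFDeriv_exp_inner_le v p ξ
      _ ≤ (A * l) ^ p := by gcongr
      _ = A ^ p * l ^ p := mul_pow _ _ _
      _ ≤ A ^ (M + 1) * l := by
        gcongr
        · omega
        · exact pow_le_of_le_one hl hl1 (by omega)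
      _ ≤ _ := le_mul_of_one_le_right (by positivity) (by linarith)

theorem HormClass.exists_norm_iteratedFDeriv_sub_le {n : ℕ} {δ : ℝ} (hδ0 : 0 ≤ δ) (hδ1 : δ < 1)
    {b : Rn n → Rn n → ℂ} (hb : HormClass (-(n : ℝ)) 0 δ b) (M : ℕ) :
    ∃ C : ℝ, 0 ≤ C ∧ ∀ p ≤ M, ∀ x z ξ : Rn n,
      ‖iteratedFDeriv ℝ p (b x) ξ - iteratedFDeriv ℝ p (b z) ξ‖ ≤
        C * ((1 + ‖ξ‖) * ((1 + ‖ξ‖) ^ n)⁻¹) * ‖x - z‖ := by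
  obtain ⟨C, hC, h⟩ := hb.exists_norm_iteratedFDeriv_iteratedFDeriv_le hδ0 (M + 1)
  refine ⟨C, hC, fun p hp x z ξ => ?_⟩
  have hd : Differentiable ℝ fun y => iteratedFDeriv ℝ p (b y) ξ :=
    (contDiff_slice_left (contDiff_uncurry_iteratedFDeriv hb.1 p) ξ).differentiable (by simp)
  refine Convex.norm_image_sub_le_of_norm_fderiv_le (𝕜 := ℝ) (s := Set.univ)
    (f := fun y => iteratedFDeriv ℝ p (b y) ξ)
    (fun y _ => hd y) (fun y _ => ?_) convex_univ (Set.mem_univ z) (Set.mem_univ x)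
  have h1 := h p (by omega) 1 (by omega) y ξ
  rw [norm_iteratedFDeriv_one, pow_one] at h1
  refine h1.trans ?_
  have h2 : (1 + ‖ξ‖) ^ δ ≤ 1 + ‖ξ‖ := by
    calc (1 + ‖ξ‖) ^ δ ≤ (1 + ‖ξ‖) ^ (1 : ℝ) :=
          Real.rpow_le_rpow_of_exponent_le (by linarith [norm_nonneg ξ]) hδ1.le
      _ = _ := Real.rpow_one _
  calc _ ≤ C * ((1 + ‖ξ‖) ^ n)⁻¹ * (1 + ‖ξ‖) := by gcongr
    _ = _ := by ring

theorem HormClass.exists_norm_iteratedFDeriv_right_le {n : ℕ} {δ : ℝ} (hδ0 : 0 ≤ δ)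
    {b : Rn n → Rn n → ℂ} (hb : HormClass (-(n : ℝ)) 0 δ b) (M : ℕ) :
    ∃ C : ℝ, 0 ≤ C ∧ ∀ p ≤ M, ∀ x ξ : Rn n,
      ‖iteratedFDeriv ℝ p (b x) ξ‖ ≤ C * ((1 + ‖ξ‖) ^ n)⁻¹ := by
  obtain ⟨C, hC, h⟩ := hb.exists_norm_iteratedFDeriv_iteratedFDeriv_le hδ0 M
  refine ⟨C, hC, fun p hp x ξ => ?_⟩
  have h1 := h p hp 0 (Nat.zero_le _) x ξ
  rwa [norm_iteratedFDeriv_zero, pow_zero, mul_one] at h1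

theorem exists_norm_iteratedFDeriv_exp_mul_sub_mul_le {n : ℕ} {δ : ℝ}
    (hδ0 : 0 ≤ δ) (hδ1 : δ < 1) {H A : ℝ} (hH : 0 ≤ H) (hA : 1 ≤ A)
    {b : Rn n → Rn n → ℂ} (hb : HormClass (-(n : ℝ)) 0 δ b) (M : ℕ) :
    ∃ C : ℝ, 0 ≤ C ∧ ∀ p ≤ M, ∀ (l : ℝ) (x z : Rn n) (χ : Rn n → ℂ), 0 ≤ l → l ≤ 1 →
      ‖x - z‖ ≤ A * l → ContDiff ℝ (⊤ : ℕ∞) χ → (∀ p ≤ M, ∀ ξ, ‖iteratedFDeriv ℝ p χ ξ‖ ≤ H) →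
      ∀ ξ, ‖iteratedFDeriv ℝ p (fun ξ => ((Complex.exp (Complex.I * ((⟪x - z, ξ⟫_ℝ : ℝ) : ℂ)) - 1) *
        b x ξ + (b x ξ - b z ξ)) * χ ξ) ξ‖ ≤ C * l * ((1 + ‖ξ‖) * ((1 + ‖ξ‖) ^ n)⁻¹) := by
  obtain ⟨C₁, hC₁, h₁⟩ := hb.exists_norm_iteratedFDeriv_right_le hδ0 M
  obtain ⟨C₂, hC₂, h₂⟩ := hb.exists_norm_iteratedFDeriv_sub_le hδ0 hδ1 M
  set B : ℝ := 2 ^ M * (A ^ (M + 1) * C₁) + C₂ * A with hB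
  refine ⟨2 ^ M * (B * H), by positivity, fun p hp l x z χ hl hl1 hxz hχ hχH ξ => ?_⟩
  set W : ℝ := (1 + ‖ξ‖) * ((1 + ‖ξ‖) ^ n)⁻¹ with hW
  have hE : ContDiff ℝ (⊤ : ℕ∞) fun ξ : Rn n =>
      Complex.exp (Complex.I * ((⟪x - z, ξ⟫_ℝ : ℝ) : ℂ)) - 1 :=
    (contDiff_exp_inner (x - z)).sub contDiff_const
  have hx := contDiff_slice_right hb.1 x
  have hz := contDiff_slice_right hb.1 z
  have le : ∀ {i : ℕ}, (i : WithTop ℕ∞) ≤ ((⊤ : ℕ∞) : WithTop ℕ∞) :=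
    fun {i} => by exact_mod_cast le_top
  have hprod : ∀ i ≤ p, ‖iteratedFDeriv ℝ i (fun ξ =>
      (Complex.exp (Complex.I * ((⟪x - z, ξ⟫_ℝ : ℝ) : ℂ)) - 1) * b x ξ) ξ‖ ≤
        2 ^ M * (A ^ (M + 1) * C₁) * l * W := by
    intro i hi
    have := norm_iteratedFDeriv_mul_le_of_le (p := i) (x := ξ) (R := 1)
      (F := A ^ (M + 1) * l * (1 + ‖ξ‖)) (G := C₁ * ((1 + ‖ξ‖) ^ n)⁻¹) (hE.of_le le) (hx.of_le le)
      (by positivity) zero_le_one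
      (fun j hj => by
        rw [one_pow, mul_one]
        exact norm_iteratedFDeriv_exp_inner_sub_one_le hA hl hl1 hxz
          (hj.trans (hi.trans hp)) ξ)
      (fun j hj => by
        rw [one_pow, mul_one]
        exact h₁ j (hj.trans (hi.trans hp)) x ξ)
    rw [one_pow, mul_one] at this
    refine this.trans ?_
    calc _ ≤ 2 ^ M * (A ^ (M + 1) * l * (1 + ‖ξ‖) * (C₁ * ((1 + ‖ξ‖) ^ n)⁻¹)) := by
          gcongr
          · norm_num
          · exact hi.trans hp
      _ = _ := by rw [hW]; ring
  have hsum : ∀ i ≤ p, ‖iteratedFDeriv ℝ i (fun ξ =>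
      (Complex.exp (Complex.I * ((⟪x - z, ξ⟫_ℝ : ℝ) : ℂ)) - 1) * b x ξ + (b x ξ - b z ξ)) ξ‖ ≤
        B * l * W := by
    intro i hi
    rw [fun_iteratedFDeriv_add ((hE.mul hx).of_le le) ((hx.sub hz).of_le le),
      fun_iteratedFDeriv_sub (hx.of_le le) (hz.of_le le)]
    calc _ ≤ 2 ^ M * (A ^ (M + 1) * C₁) * l * W + C₂ * W * (A * l) := by
          refine (norm_add_le _ _).trans (add_le_add (hprod i hi) ?_)
          refine (h₂ i (hi.trans hp) x z ξ).trans ?_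
          gcongr
      _ = _ := by rw [hB]; ring
  have := norm_iteratedFDeriv_mul_le_of_le (p := p) (x := ξ) (R := 1)
    (F := B * l * W) (G := H) (((hE.mul hx).add (hx.sub hz)).of_le le) (hχ.of_le le)
    (by positivity) zero_le_one
    (fun j hj => by rw [one_pow, mul_one]; exact hsum j hj)
    (fun j hj => by rw [one_pow, mul_one]; exact hχH j (hj.trans hp) ξ)
  rw [one_pow, mul_one] at this
  refine this.trans ?_
  calc _ ≤ 2 ^ M * (B * l * W * H) := by
        gcongr
        norm_num
    _ = _ := by ring

theorem integrableOn_closedBall_one_add_norm {n : ℕ} (c R : ℝ) :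
    IntegrableOn (fun ξ : Rn n => c * ((1 + ‖ξ‖) * ((1 + ‖ξ‖) ^ n)⁻¹))
      (Metric.closedBall 0 R) := by
  refine ContinuousOn.integrableOn_compact (isCompact_closedBall _ _) (Continuous.continuousOn ?_)
  refine continuous_const.mul (Continuous.mul (by fun_prop) (Continuous.inv₀ (by fun_prop) ?_))
  intro ξ
  positivity

theorem setIntegral_closedBall_one_add_norm_le {n : ℕ} (hn : 1 ≤ n) {R : ℝ} (hR : 0 ≤ R) :
    ∫ ξ : Rn n in Metric.closedBall 0 R, (1 + ‖ξ‖) * ((1 + ‖ξ‖) ^ n)⁻¹ ≤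
      n * volume.real (Metric.ball (0 : Rn n) 1) * R := by
  have : Nonempty (Fin n) := ⟨⟨0, hn⟩⟩
  set g : ℝ → ℝ := (Set.Iic R).indicator fun r => (1 + r) * ((1 + r) ^ n)⁻¹ with hg
  have h1 : ∫ ξ : Rn n in Metric.closedBall 0 R, (1 + ‖ξ‖) * ((1 + ‖ξ‖) ^ n)⁻¹ =
      ∫ ξ : Rn n, g ‖ξ‖ := by
    rw [← integral_indicator measurableSet_closedBall]
    congr 1
    funext ξ
    by_cases hξ : ‖ξ‖ ≤ R <;> simp [hg, hξ]
  rw [h1, integral_fun_norm_addHaar volume g, finrank_euclideanSpace_fin, nsmul_eq_mul,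
    smul_eq_mul, ← mul_assoc]
  gcongr
  have h2 : ∀ r ∈ Set.Ioi (0 : ℝ),
      ‖r ^ (n - 1) • g r‖ ≤ (Set.Ioc 0 R).indicator (fun _ => 1) r := by
    intro r hr
    have hr0 : 0 < r := hr
    by_cases hrR : r ≤ R
    · rw [hg, Set.indicator_of_mem (Set.mem_Iic.2 hrR),
        Set.indicator_of_mem (Set.mem_Ioc.2 ⟨hr0, hrR⟩),
        Real.norm_of_nonneg (by positivity), smul_eq_mul, ← mul_assoc,
        mul_inv_le_iff₀ (by positivity), one_mul]
      calc r ^ (n - 1) * (1 + r) ≤ (1 + r) ^ (n - 1) * (1 + r) := by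
            gcongr
            linarith
        _ = (1 + r) ^ n := by rw [← pow_succ, Nat.sub_add_cancel hn]
    · rw [hg, Set.indicator_of_notMem (by simpa using hrR)]
      simp [hrR]
  have hi : Integrable ((Set.Ioc 0 R).indicator fun _ => (1 : ℝ)) :=
    (integrable_indicator_iff measurableSet_Ioc).2 (by simp)
  calc ∫ r in Set.Ioi (0 : ℝ), r ^ (n - 1) • g r
      ≤ ‖∫ r in Set.Ioi (0 : ℝ), r ^ (n - 1) • g r‖ := le_abs_self _
    _ ≤ ∫ r in Set.Ioi (0 : ℝ), (Set.Ioc 0 R).indicator (fun _ => (1 : ℝ)) r :=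
        norm_integral_le_of_norm_le hi.integrableOn
          ((ae_restrict_iff' measurableSet_Ioi).2 (Filter.Eventually.of_forall h2))
    _ ≤ ∫ r, (Set.Ioc 0 R).indicator (fun _ => (1 : ℝ)) r :=
        setIntegral_le_integral hi (Filter.Eventually.of_forall fun r =>
          Set.indicator_nonneg (fun _ _ => zero_le_one) r)
    _ = R := by
        rw [integral_indicator measurableSet_Ioc]
        simp [hR]

theorem oscKernel_sub_oscKernel {n : ℕ} {b : Rn n → Rn n → ℂ} {χ : Rn n → ℂ} {x z : Rn n}
    (hx : Continuous (b x)) (hz : Continuous (b z)) (hχ : Continuous χ)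
    (hχc : HasCompactSupport χ) (y : Rn n) :
    oscKernel b χ x y - oscKernel b χ z y =
      ∫ ξ, Complex.exp (Complex.I * ((⟪ξ, z - y⟫_ℝ : ℝ) : ℂ)) *
        (((Complex.exp (Complex.I * ((⟪x - z, ξ⟫_ℝ : ℝ) : ℂ)) - 1) * b x ξ +
          (b x ξ - b z ξ)) * χ ξ) := by
  have hInt : ∀ w, Continuous (b w) → Integrable fun ξ =>
      Complex.exp (Complex.I * ((⟪w - y, ξ⟫_ℝ : ℝ) : ℂ)) * (b w ξ * χ ξ) := fun w hw =>
    Continuous.integrable_of_hasCompactSupport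
      (Continuous.mul (by fun_prop) (hw.mul hχ)) hχc.mul_left.mul_left
  rw [oscKernel, oscKernel, ← integral_sub (hInt x hx) (hInt z hz)]
  congr 1
  funext ξ
  have h : Complex.exp (Complex.I * ((⟪x - y, ξ⟫_ℝ : ℝ) : ℂ)) =
      Complex.exp (Complex.I * ((⟪z - y, ξ⟫_ℝ : ℝ) : ℂ)) *
        Complex.exp (Complex.I * ((⟪x - z, ξ⟫_ℝ : ℝ) : ℂ)) := by
    rw [← Complex.exp_add, ← mul_add, ← Complex.ofReal_add, ← inner_add_left]
    congr 5
    abel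
  rw [h, real_inner_comm (z - y) ξ]
  ring

theorem exists_norm_oscKernel_sub_le {n : ℕ} (hn : 1 ≤ n) {δ : ℝ}
    (hδ0 : 0 ≤ δ) (hδ1 : δ < 1) {H A : ℝ} (hH : 0 ≤ H) (hA : 1 ≤ A)
    {b : Rn n → Rn n → ℂ} (hb : HormClass (-(n : ℝ)) 0 δ b) (M : ℕ) :
    ∃ C : ℝ, 0 ≤ C ∧ ∀ (l : ℝ) (x z y : Rn n) (χ : Rn n → ℂ), 0 < l → l ≤ 1 →
      ‖x - z‖ ≤ A * l → ContDiff ℝ (⊤ : ℕ∞) χ →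
      (∀ p ≤ M, ∀ ξ, ‖iteratedFDeriv ℝ p χ ξ‖ ≤ H) → (∀ ξ, 2 * l⁻¹ < ‖ξ‖ → χ ξ = 0) →
      ‖oscKernel b χ x y - oscKernel b χ z y‖ ≤ C * ((1 + ‖z - y‖) ^ M)⁻¹ := by
  obtain ⟨C, hC, h⟩ := exists_norm_iteratedFDeriv_exp_mul_sub_mul_le hδ0 hδ1 hH hA hb M
  set D : ℝ := C * (n * volume.real (Metric.ball (0 : Rn n) 1) * 2) with hD
  have hD0 : 0 ≤ D := by positivity
  refine ⟨2 ^ M * (D + (4 * π) ^ M * ((M + 1) * D)), by positivity,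
    fun l x z y χ hl hl1 hxz hχ hχH hχ0 => ?_⟩
  have hx := contDiff_slice_right hb.1 x
  have hz := contDiff_slice_right hb.1 z
  have hsupp : tsupport χ ⊆ Metric.closedBall 0 (2 * l⁻¹) :=
    closure_minimal (fun ξ hξ => by
      by_contra hn
      exact hξ (hχ0 ξ (by simpa using hn))) Metric.isClosed_closedBall
  have hχc : HasCompactSupport χ := (isCompact_closedBall _ _).of_isClosed_subset
    (isClosed_tsupport χ) hsupp
  rw [oscKernel_sub_oscKernel hx.continuous hz.continuous hχ.continuous hχc]
  set G : Rn n → ℂ := fun ξ => ((Complex.exp (Complex.I * ((⟪x - z, ξ⟫_ℝ : ℝ) : ℂ)) - 1) *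
    b x ξ + (b x ξ - b z ξ)) * χ ξ with hG
  have hGd : ContDiff ℝ (⊤ : ℕ∞) G :=
    ((((contDiff_exp_inner (x - z)).sub contDiff_const).mul hx).add (hx.sub hz)).mul hχ
  have hGc : HasCompactSupport G := hχc.mul_left
  have hGs : tsupport G ⊆ Metric.closedBall 0 (2 * l⁻¹) :=
    (tsupport_mul_subset_right (f := fun ξ =>
      (Complex.exp (Complex.I * ((⟪x - z, ξ⟫_ℝ : ℝ) : ℂ)) - 1) *
        b x ξ + (b x ξ - b z ξ)) (g := χ)).trans hsupp
  have hInt : ∀ p ≤ M, ∫ ξ, ‖iteratedFDeriv ℝ p G ξ‖ ≤ D := fun p hp => by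
    have h0 : ∀ ξ, ξ ∉ Metric.closedBall (0 : Rn n) (2 * l⁻¹) → ‖iteratedFDeriv ℝ p G ξ‖ = 0 :=
      fun ξ hξ => by
        rw [norm_eq_zero]
        exact image_eq_zero_of_notMem_tsupport
          (fun h => hξ (hGs (tsupport_iteratedFDeriv_subset p h)))
    rw [← setIntegral_eq_integral_of_forall_compl_eq_zero h0]
    calc _ ≤ ∫ ξ : Rn n in Metric.closedBall 0 (2 * l⁻¹),
            C * l * ((1 + ‖ξ‖) * ((1 + ‖ξ‖) ^ n)⁻¹) := by
          refine integral_mono ?_ (integrableOn_closedBall_one_add_norm _ _)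
            fun ξ => h p hp l x z χ hl.le hl1 hxz hχ hχH ξ
          exact ((hGd.continuous_iteratedFDeriv (by exact_mod_cast le_top)).norm.continuousOn
            ).integrableOn_compact (isCompact_closedBall _ _)
      _ = C * l * ∫ ξ : Rn n in Metric.closedBall 0 (2 * l⁻¹),
            (1 + ‖ξ‖) * ((1 + ‖ξ‖) ^ n)⁻¹ := integral_const_mul _ _
      _ ≤ C * l * (n * volume.real (Metric.ball (0 : Rn n) 1) * (2 * l⁻¹)) := by
          gcongr
          exact setIntegral_closedBall_one_add_norm_le hn (by positivity)
      _ = D := by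
          rw [hD]
          field_simp
  have hbound : ∀ N ≤ M, ‖z - y‖ ^ N *
      ‖∫ ξ, Complex.exp (Complex.I * ((⟪ξ, z - y⟫_ℝ : ℝ) : ℂ)) * G ξ‖ ≤
        (4 * π) ^ N * ((N + 1) * D) := fun N hN => by
    refine (pow_mul_norm_integral_exp_mul_le hGd hGc N (z - y)).trans ?_
    gcongr
    calc _ ≤ ∑ p ∈ Finset.range (N + 1), D :=
          Finset.sum_le_sum fun p hp => hInt p (by have := Finset.mem_range.1 hp; omega)
      _ = _ := by simp
  have b0 := hbound 0 (Nat.zero_le _)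
  have bM := hbound M le_rfl
  simp only [pow_zero, one_mul, CharP.cast_eq_zero, zero_add] at b0
  set K := ‖∫ ξ, Complex.exp (Complex.I * ((⟪ξ, z - y⟫_ℝ : ℝ) : ℂ)) * G ξ‖ with hK
  rw [← div_eq_mul_inv, le_div_iff₀ (by positivity)]
  calc K * (1 + ‖z - y‖) ^ M ≤ K * (2 ^ M * (1 + ‖z - y‖ ^ M)) := by
        gcongr
        exact one_add_pow_le (norm_nonneg _) M
    _ = 2 ^ M * (K + ‖z - y‖ ^ M * K) := by ring
    _ ≤ _ := by gcongr

theorem exists_enorm_pdo_mul_sub_le {n : ℕ} (hn : 1 ≤ n) {δ : ℝ}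
    (hδ0 : 0 ≤ δ) (hδ1 : δ < 1) {H A : ℝ} (hH : 0 ≤ H) (hA : 1 ≤ A)
    {b : Rn n → Rn n → ℂ} (hb : HormClass (-(n : ℝ)) 0 δ b) (M : ℕ) :
    ∃ C : ℝ, 0 ≤ C ∧ ∀ (l : ℝ) (x z : Rn n) (χ f : Rn n → ℂ), 0 < l → l ≤ 1 →
      ‖x - z‖ ≤ A * l → ContDiff ℝ (⊤ : ℕ∞) χ → HasCompactSupport χ →
      (∀ p ≤ M, ∀ ξ, ‖iteratedFDeriv ℝ p χ ξ‖ ≤ H) → (∀ ξ, 2 * l⁻¹ < ‖ξ‖ → χ ξ = 0) →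
      Continuous f → Integrable f →
      ‖pdo (fun x ξ => b x ξ * χ ξ) f x - pdo (fun x ξ => b x ξ * χ ξ) f z‖ₑ ≤
        ENNReal.ofReal C * ∫⁻ y, ‖f y‖ₑ * ENNReal.ofReal (((1 + ‖z - y‖) ^ M)⁻¹) := by
  obtain ⟨C, hC, h⟩ := exists_norm_oscKernel_sub_le hn hδ0 hδ1 hH hA hb M
  refine ⟨C, hC, fun l x z χ f hl hl1 hxz hχ hχc hχH hχ0 hf hfi => ?_⟩
  have hx := (contDiff_slice_right hb.1 x).continuous
  have hz := (contDiff_slice_right hb.1 z).continuous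
  rw [pdo_mul_eq_integral_oscKernel hx hχ.continuous hχc hf hfi,
    pdo_mul_eq_integral_oscKernel hz hχ.continuous hχc hf hfi,
    ← integral_sub (integrable_oscKernel_mul hx hχ.continuous hχc hf hfi)
      (integrable_oscKernel_mul hz hχ.continuous hχc hf hfi),
    ← lintegral_const_mul' _ _ ENNReal.ofReal_ne_top]
  refine (enorm_integral_le_lintegral_enorm _).trans (lintegral_mono fun y => ?_)
  rw [← sub_mul, enorm_mul, mul_left_comm, mul_comm ‖f y‖ₑ, ← ENNReal.ofReal_mul hC,
    ← ofReal_norm (_ - _)]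
  gcongr
  exact h l x z y χ hl hl1 hxz hχ hχH hχ0

theorem exists_scaled_cutoff (n M : ℕ) : ∃ (χ : ℝ → Rn n → ℂ) (H : ℝ), 0 ≤ H ∧
    ∀ s, 0 < s → s ≤ 1 → ContDiff ℝ (⊤ : ℕ∞) (χ s) ∧ HasCompactSupport (χ s) ∧
      (∀ p ≤ M, ∀ ξ, ‖iteratedFDeriv ℝ p (χ s) ξ‖ ≤ H) ∧
      (∀ ξ, ‖ξ‖ ≤ s⁻¹ → χ s ξ = 1) ∧ ∀ ξ, 2 * s⁻¹ < ‖ξ‖ → χ s ξ = 0 := by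
  obtain ⟨φ, hφ, hφc, -, -, h1, h0⟩ := exists_cutoff n one_pos
  have hψ : ContDiff ℝ (⊤ : ℕ∞) fun ξ => (φ ξ : ℂ) := Complex.ofRealCLM.contDiff.comp hφ
  have hψc : HasCompactSupport fun ξ => (φ ξ : ℂ) :=
    hφc.comp_left (g := Complex.ofReal) Complex.ofReal_zero
  obtain ⟨H, hH, hb⟩ := exists_norm_iteratedFDeriv_le hψ hψc M
  refine ⟨fun s ξ => (φ (s • ξ) : ℂ), H, hH, fun s hs hs1 => ?_⟩
  have hzero : ∀ ξ, 2 * s⁻¹ < ‖ξ‖ → (φ (s • ξ) : ℂ) = 0 := fun ξ hξ => by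
    rw [h0, Complex.ofReal_zero]
    rw [norm_smul, Real.norm_of_nonneg hs.le]
    rw [← div_eq_mul_inv, div_lt_iff₀' hs] at hξ
    linarith
  refine ⟨hψ.comp (contDiff_const_smul s), ?_, fun p hp ξ => ?_, fun ξ hξ => ?_, hzero⟩
  · exact HasCompactSupport.intro (isCompact_closedBall (0 : Rn n) (2 * s⁻¹))
      fun ξ hξ => hzero ξ (by simpa using hξ)
  · rw [iteratedFDeriv_comp_const_smul (f := fun ξ => (φ ξ : ℂ)) s
      (hψ.of_le (by exact_mod_cast le_top)), norm_smul, norm_pow, Real.norm_of_nonneg hs.le]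
    exact (mul_le_of_le_one_left (norm_nonneg _) (pow_le_one₀ hs.le hs1)).trans (hb p hp _)
  · change (φ (s • ξ) : ℂ) = 1
    rw [h1, Complex.ofReal_one]
    rw [norm_smul, Real.norm_of_nonneg hs.le]
    rwa [← one_div, le_div_iff₀' hs] at hξ

open scoped FourierTransform in
theorem ft_eq_fourier {n : ℕ} (f : SchwartzMap (Rn n) ℂ) :
    ft f = fun ξ => 𝓕 f ((2 * π)⁻¹ • ξ) := by
  funext ξ
  rw [SchwartzMap.fourier_coe, Real.fourier_eq', ft]
  refine integral_congr_ae (Filter.Eventually.of_forall fun x => ?_)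
  have : -2 * π * ⟪x, (2 * π)⁻¹ • ξ⟫_ℝ = -⟪x, ξ⟫_ℝ := by
    rw [inner_smul_right]
    field_simp
  simp only [this]
  rw [smul_eq_mul, Complex.ofReal_neg, neg_mul, mul_comm Complex.I]

theorem continuous_ft {n : ℕ} (f : SchwartzMap (Rn n) ℂ) : Continuous (ft f) := by
  rw [ft_eq_fourier]
  exact (SchwartzMap.continuous _).comp (continuous_const_smul _)

theorem integrable_ft {n : ℕ} (f : SchwartzMap (Rn n) ℂ) : Integrable (ft f) := by
  rw [ft_eq_fourier]
  exact (SchwartzMap.integrable _).comp_smul (by positivity)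

theorem measurable_pdo {n : ℕ} {b : Rn n → Rn n → ℂ} (hb : Continuous (Function.uncurry b))
    (f : SchwartzMap (Rn n) ℂ) : Measurable (pdo b f) := by
  have h : Continuous fun q : Rn n × Rn n =>
      Complex.exp (Complex.I * ((⟪q.1, q.2⟫_ℝ : ℝ) : ℂ)) * b q.1 q.2 * ft f q.2 :=
    (Continuous.mul (by fun_prop) hb).mul ((continuous_ft f).comp continuous_snd)
  exact (StronglyMeasurable.integral_prod_right (ν := (volume : Measure (Rn n)))
    (f := fun x ξ => Complex.exp (Complex.I * ((⟪x, ξ⟫_ℝ : ℝ) : ℂ)) * b x ξ * ft f ξ)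
    h.measurable.stronglyMeasurable).measurable

theorem norm_exp_inner_mul_mul_le {n : ℕ} (x ξ : Rn n) {c w : ℂ} {B : ℝ} (hc : ‖c‖ ≤ B) :
    ‖Complex.exp (Complex.I * ((⟪x, ξ⟫_ℝ : ℝ) : ℂ)) * c * w‖ ≤ B * ‖w‖ := by
  rw [norm_mul, norm_mul, mul_comm Complex.I, Complex.norm_exp_ofReal_mul_I, one_mul]
  gcongr

theorem integrable_exp_inner_mul_mul_ft {n : ℕ} {g : Rn n → ℂ} (hg : Continuous g) {B : ℝ}
    (hB : ∀ ξ, ‖g ξ‖ ≤ B) (f : SchwartzMap (Rn n) ℂ) (x : Rn n) :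
    Integrable fun ξ => Complex.exp (Complex.I * ((⟪x, ξ⟫_ℝ : ℝ) : ℂ)) * g ξ * ft f ξ :=
  ((integrable_ft f).norm.const_mul B).mono'
    ((Continuous.mul (by fun_prop) hg).mul (continuous_ft f)).aestronglyMeasurable
    (Filter.Eventually.of_forall fun ξ => norm_exp_inner_mul_mul_le x ξ (hB ξ))

theorem tendsto_pdo_mul_sub {n : ℕ} {b : Rn n → Rn n → ℂ} {x : Rn n} (hb : Continuous (b x))
    {B H : ℝ} (hB : ∀ ξ, ‖b x ξ‖ ≤ B) {χ : ℕ → Rn n → ℂ} {η : Rn n → ℂ}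
    (hχ : ∀ k, Continuous (χ k)) (hη : Continuous η)
    (hχH : ∀ k ξ, ‖χ k ξ‖ ≤ H) (hηH : ∀ ξ, ‖η ξ‖ ≤ H)
    (hlim : ∀ ξ, Filter.Tendsto (fun k => χ k ξ) Filter.atTop (nhds 1))
    (f : SchwartzMap (Rn n) ℂ) :
    Filter.Tendsto (fun k => pdo (fun x ξ => b x ξ * (χ k ξ - η ξ)) f x) Filter.atTop
      (nhds (pdo b f x - pdo (fun x ξ => b x ξ * η ξ) f x)) := by
  have hB0 : 0 ≤ B := (norm_nonneg _).trans (hB 0)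
  have hbη : ∀ ξ, ‖b x ξ * η ξ‖ ≤ B * H := fun ξ => by
    rw [norm_mul]
    exact mul_le_mul (hB ξ) (hηH ξ) (norm_nonneg _) hB0
  have e : pdo b f x - pdo (fun x ξ => b x ξ * η ξ) f x =
      ∫ ξ, Complex.exp (Complex.I * ((⟪x, ξ⟫_ℝ : ℝ) : ℂ)) * (b x ξ * (1 - η ξ)) * ft f ξ := by
    rw [pdo, pdo, ← integral_sub (integrable_exp_inner_mul_mul_ft hb hB f x)
      (integrable_exp_inner_mul_mul_ft (g := fun ξ => b x ξ * η ξ) (hb.mul hη) hbη f x)]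
    congr 1
    funext ξ
    ring
  rw [e]
  refine tendsto_integral_of_dominated_convergence (fun ξ => B * (H + H) * ‖ft f ξ‖)
    (fun k => ?_) ((integrable_ft f).norm.const_mul _) (fun k => ?_) ?_
  · exact ((Continuous.mul (by fun_prop) (hb.mul ((hχ k).sub hη))).mul
      (continuous_ft f)).aestronglyMeasurable
  · refine Filter.Eventually.of_forall fun ξ => norm_exp_inner_mul_mul_le x ξ ?_
    rw [norm_mul]
    exact mul_le_mul (hB ξ) ((norm_sub_le _ _).trans (add_le_add (hχH k ξ) (hηH ξ)))
      (norm_nonneg _) hB0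
  · exact Filter.Eventually.of_forall fun ξ =>
      (((hlim ξ).sub_const (η ξ)).const_mul (b x ξ)).const_mul _ |>.mul_const _

/-- The high-frequency part of a pseudo-differential operator, averaged over a small cube. -/
theorem exists_lintegral_cube_pdo_sub_le {n : ℕ} (hn : 1 ≤ n) {δ : ℝ}
    (hδ0 : 0 ≤ δ) (hδ1 : δ < 1) {H : ℝ} (hH : 0 ≤ H) (M : ℕ)
    {b : Rn n → Rn n → ℂ} (hb : HormClass (-(n : ℝ)) 0 δ b) :
    ∃ C : ℝ, 0 ≤ C ∧ ∀ (l : ℝ) (z : Rn n) (η : Rn n → ℂ) (f : SchwartzMap (Rn n) ℂ),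
      0 < l → l ≤ 1 → ContDiff ℝ (⊤ : ℕ∞) η → HasCompactSupport η →
      (∀ p ≤ M, ∀ ξ, ‖iteratedFDeriv ℝ p η ξ‖ ≤ H) → (∀ ξ, 1 + ‖ξ‖ < l⁻¹ → η ξ = 1) →
      ∫⁻ x in cube z l, ‖pdo b f x - pdo (fun x ξ => b x ξ * η ξ) f x‖ₑ ≤
        ENNReal.ofReal (C * l ^ n) *
          ∫⁻ y, ‖f y‖ₑ * ENNReal.ofReal (((1 + ‖z - y‖) ^ M)⁻¹) := by
  obtain ⟨χ, H', hH', hχ⟩ := exists_scaled_cutoff n M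
  obtain ⟨C, hC, h⟩ := exists_lintegral_cube_pdo_mul_le hn hδ0 hδ1 (add_nonneg hH' hH) M hb
  obtain ⟨B, hB0, hB⟩ := hb.exists_norm_iteratedFDeriv_right_le hδ0 0
  refine ⟨C, hC, fun l z η f hl hl1 hη hηc hηH hη1 => ?_⟩
  set s : ℕ → ℝ := fun k => l / (k + 1) with hs
  have hs0 : ∀ k, 0 < s k := fun k => by positivity
  have hsl : ∀ k, s k ≤ l := fun k => div_le_self hl.le (by linarith [k.cast_nonneg (α := ℝ)])
  have hc := fun k => hχ (s k) (hs0 k) ((hsl k).trans hl1)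
  have hsinv : ∀ k, (s k)⁻¹ = (k + 1) / l := fun k => inv_div _ _
  have hlim : ∀ ξ, Filter.Tendsto (fun k => χ (s k) ξ) Filter.atTop (nhds 1) := fun ξ => by
    refine tendsto_const_nhds.congr' ?_
    obtain ⟨N, hN⟩ := exists_nat_ge (‖ξ‖ * l)
    filter_upwards [Filter.eventually_ge_atTop N] with k hk
    refine ((hc k).2.2.2.1 ξ ?_).symm
    rw [hsinv, le_div_iff₀ hl]
    have : (N : ℝ) ≤ k := by exact_mod_cast hk
    linarith
  have norm_le : ∀ {θ : Rn n → ℂ} {D : ℝ}, (∀ p ≤ M, ∀ ξ, ‖iteratedFDeriv ℝ p θ ξ‖ ≤ D) →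
      ∀ ξ, ‖θ ξ‖ ≤ D := fun hθ ξ => (norm_iteratedFDeriv_zero (𝕜 := ℝ)).symm.trans_le
    (hθ 0 (Nat.zero_le _) ξ)
  have hBx : ∀ x ξ, ‖b x ξ‖ ≤ B := fun x ξ => by
    have := hB 0 le_rfl x ξ
    rw [norm_iteratedFDeriv_zero] at this
    refine this.trans (mul_le_of_le_one_right hB0 (inv_le_one_of_one_le₀ (one_le_pow₀ ?_)))
    linarith [norm_nonneg ξ]
  have hT : ∀ x, Filter.Tendsto (fun k => ‖pdo (fun x ξ => b x ξ * (χ (s k) ξ - η ξ)) f x‖ₑ)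
      Filter.atTop (nhds ‖pdo b f x - pdo (fun x ξ => b x ξ * η ξ) f x‖ₑ) := fun x =>
    (continuous_enorm.tendsto _).comp (tendsto_pdo_mul_sub (H := H' + H)
      (contDiff_slice_right hb.1 x).continuous (hBx x) (fun k => (hc k).1.continuous)
      hη.continuous (fun k ξ => (norm_le (hc k).2.2.1 ξ).trans (le_add_of_nonneg_right hH))
      (fun ξ => (norm_le hηH ξ).trans (le_add_of_nonneg_left hH')) hlim f)
  have hmeas : ∀ k, Measurable fun x => ‖pdo (fun x ξ => b x ξ * (χ (s k) ξ - η ξ)) f x‖ₑ :=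
    fun k => (measurable_pdo (hb.1.continuous.mul
      (((hc k).1.continuous.sub hη.continuous).comp continuous_snd)) f).enorm
  calc _ = ∫⁻ x in cube z l, Filter.liminf
            (fun k => ‖pdo (fun x ξ => b x ξ * (χ (s k) ξ - η ξ)) f x‖ₑ) Filter.atTop :=
        lintegral_congr fun x => (hT x).liminf_eq.symm
    _ ≤ Filter.liminf (fun k => ∫⁻ x in cube z l,
            ‖pdo (fun x ξ => b x ξ * (χ (s k) ξ - η ξ)) f x‖ₑ) Filter.atTop :=
        lintegral_liminf_le hmeas
    _ ≤ Filter.liminf (fun _ : ℕ => ENNReal.ofReal (C * l ^ n) *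
          ∫⁻ y, ‖f y‖ₑ * ENNReal.ofReal (((1 + ‖z - y‖) ^ M)⁻¹)) Filter.atTop := by
        refine Filter.liminf_le_liminf (Filter.Eventually.of_forall fun k => ?_)
        refine h l z (fun ξ => χ (s k) ξ - η ξ) f hl hl1 ((hc k).1.sub hη)
          ((hc k).2.1.sub hηc) (fun p hp ξ => ?_) (fun ξ hξ => ?_) f.continuous f.integrable
        · rw [fun_iteratedFDeriv_sub ((hc k).1.of_le (by exact_mod_cast le_top))
            (hη.of_le (by exact_mod_cast le_top))]
          exact (norm_sub_le _ _).trans (add_le_add ((hc k).2.2.1 p hp ξ) (hηH p hp ξ))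
        · rw [hη1 ξ hξ, (hc k).2.2.2.1 ξ, sub_self]
          have := inv_anti₀ (hs0 k) (hsl k)
          linarith
    _ = _ := Filter.liminf_const _

theorem exists_lintegral_small_cube_pdo_sub_le {n : ℕ} (hn : 1 ≤ n) {δ : ℝ}
    (hδ0 : 0 ≤ δ) (hδ1 : δ < 1) {b : Rn n → Rn n → ℂ} (hb : HormClass (-(n : ℝ)) 0 δ b) :
    ∃ C : ℝ, 0 ≤ C ∧ ∀ (l : ℝ) (z x : Rn n) (f : SchwartzMap (Rn n) ℂ),
      0 < l → l ≤ 1 → x ∈ cube z l →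
      ∃ c : ℂ, ∫⁻ y in cube z l, ‖pdo b f y - c‖ₑ ≤
        ENNReal.ofReal C * mHL f x * ENNReal.ofReal (l ^ n) := by
  obtain ⟨χ, H, hH, hχ⟩ := exists_scaled_cutoff n (2 * n + 2)
  obtain ⟨C₁, hC₁, h₁⟩ := exists_lintegral_cube_pdo_sub_le hn hδ0 hδ1 hH (2 * n + 2) hb
  obtain ⟨C₂, hC₂, h₂⟩ := exists_enorm_pdo_mul_sub_le hn hδ0 hδ1 hH
    (A := n) (by exact_mod_cast hn) hb (2 * n + 2)
  have hS : 0 ≤ sumInvSq := tsum_nonneg fun _ => by positivity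
  refine ⟨(C₁ + C₂) * (2 ^ n * sumInvSq), by positivity, fun l z x f hl hl1 hx => ?_⟩
  obtain ⟨hc, hcc, hcH, hc1, hc0⟩ := hχ l hl hl1
  set T := pdo (fun x ξ => b x ξ * χ l ξ) f with hT
  set W := ∫⁻ y, ‖f y‖ₑ * ENNReal.ofReal (((1 + ‖z - y‖) ^ (2 * n + 2))⁻¹) with hW
  have hTm : Measurable T :=
    measurable_pdo (hb.1.continuous.mul (hc.continuous.comp continuous_snd)) f
  have hlow : ∫⁻ y in cube z l, ‖T y - T z‖ₑ ≤ ENNReal.ofReal (C₂ * l ^ n) * W := by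
    refine (setLIntegral_mono (g := fun _ => ENNReal.ofReal C₂ * W) measurable_const
      fun y hy => h₂ l y z (χ l) f hl hl1 (norm_sub_le_of_mem_cube hy) hc hcc hcH hc0
        f.continuous f.integrable).trans_eq ?_
    rw [setLIntegral_const, volume_cube z hl.le, ENNReal.ofReal_mul hC₂]
    ring
  refine ⟨T z, ?_⟩
  calc ∫⁻ y in cube z l, ‖pdo b f y - T z‖ₑ
      ≤ ∫⁻ y in cube z l, (‖pdo b f y - T y‖ₑ + ‖T y - T z‖ₑ) := by
        refine lintegral_mono fun y => ?_
        rw [← sub_add_sub_cancel (pdo b f y) (T y) (T z)]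
        exact enorm_add_le _ _
    _ = (∫⁻ y in cube z l, ‖pdo b f y - T y‖ₑ) + ∫⁻ y in cube z l, ‖T y - T z‖ₑ :=
        lintegral_add_right _ (hTm.sub_const _).enorm
    _ ≤ ENNReal.ofReal (C₁ * l ^ n) * W + ENNReal.ofReal (C₂ * l ^ n) * W :=
        add_le_add (h₁ l z (χ l) f hl hl1 hc hcc hcH fun ξ hξ => hc1 ξ (by linarith)) hlow
    _ = ENNReal.ofReal ((C₁ + C₂) * l ^ n) * W := by
        rw [← add_mul, ← ENNReal.ofReal_add (by positivity) (by positivity), add_mul]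
    _ ≤ ENNReal.ofReal ((C₁ + C₂) * l ^ n) * (ENNReal.ofReal (2 ^ n * sumInvSq) * mHL f x) := by
        gcongr
        exact lintegral_weight_le_mHL f.continuous.measurable hl1 hx
    _ = _ := by
        rw [ENNReal.ofReal_mul (by positivity), ENNReal.ofReal_mul (p := C₁ + C₂) (by positivity)]
        ring

theorem exists_lintegral_large_cube_pdo_le {n : ℕ} (hn : 1 ≤ n) {δ : ℝ}
    (hδ0 : 0 ≤ δ) (hδ1 : δ < 1) {b : Rn n → Rn n → ℂ} (hb : HormClass (-(n : ℝ)) 0 δ b) :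
    ∃ C : ℝ, 0 ≤ C ∧ ∀ (l : ℝ) (z x : Rn n) (f : SchwartzMap (Rn n) ℂ),
      1 ≤ l → x ∈ cube z l →
      ∫⁻ y in cube z l, ‖pdo b f y‖ₑ ≤
        ENNReal.ofReal C * mHL f x * ENNReal.ofReal (l ^ n) := by
  obtain ⟨C, hC, h⟩ := exists_lintegral_cube_pdo_sub_le hn hδ0 hδ1 le_rfl (2 * n + 2) hb
  have hS : 0 ≤ sumInvSq := tsum_nonneg fun _ => by positivity
  refine ⟨C * (8 ^ n * sumInvSq), by positivity, fun l z x f hl hx => ?_⟩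
  have hunit : ∀ w, ∫⁻ y in cube w 1, ‖pdo b f y‖ₑ ≤ ENNReal.ofReal C *
      ∫⁻ y, ‖f y‖ₑ * ENNReal.ofReal (((1 + ‖w - y‖) ^ (2 * n + 2))⁻¹) := fun w => by
    have := h 1 w 0 f one_pos le_rfl contDiff_const HasCompactSupport.zero
      (fun p _ ξ => by simp) (fun ξ hξ => by
        rw [inv_one] at hξ
        linarith [norm_nonneg ξ])
    simpa [pdo] using this
  calc ∫⁻ y in cube z l, ‖pdo b f y‖ₑ
      ≤ ∫⁻ w in cube z (l + 1), ∫⁻ y in cube w 1, ‖pdo b f y‖ₑ :=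
        lintegral_cube_le_lintegral_lintegral_unit_cube
          (measurable_pdo hb.1.continuous f).enorm z l
    _ ≤ ∫⁻ w in cube z (l + 1), ENNReal.ofReal C *
          ∫⁻ y, ‖f y‖ₑ * ENNReal.ofReal (((1 + ‖w - y‖) ^ (2 * n + 2))⁻¹) :=
        lintegral_mono hunit
    _ = ENNReal.ofReal C * ∫⁻ w in cube z (l + 1),
          ∫⁻ y, ‖f y‖ₑ * ENNReal.ofReal (((1 + ‖w - y‖) ^ (2 * n + 2))⁻¹) :=
        lintegral_const_mul' _ _ ENNReal.ofReal_ne_top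
    _ ≤ ENNReal.ofReal C * (ENNReal.ofReal (l ^ n) *
          (ENNReal.ofReal (8 ^ n * sumInvSq) * mHL f x)) := by
        gcongr
        exact lintegral_cube_lintegral_weight_le_mHL f.continuous.measurable hl hx
    _ = _ := by
        rw [ENNReal.ofReal_mul hC]
        ring

/-- If `a ∈ S^{-n}_{0,δ}` with `0 ≤ δ < 1`, then
`M^♯(T_a f)(x) ≤ C M f(x)` for all Schwartz `f` and all `x`. -/
theorem stmt2 (n : ℕ) (hn : 1 ≤ n) (δ : ℝ) (hδ0 : 0 ≤ δ) (hδ1 : δ < 1)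
    (a : Rn n → Rn n → ℂ) (ha : HormClass (-(n : ℝ)) 0 δ a) :
    ∃ C : ℝ, 0 < C ∧ ∀ f : SchwartzMap (Rn n) ℂ, ∀ x : Rn n,
      mSharp (pdo a (⇑f)) x ≤ ENNReal.ofReal C * mHL (⇑f) x := by
  obtain ⟨C₁, hC₁, h₁⟩ := exists_lintegral_small_cube_pdo_sub_le hn hδ0 hδ1 ha
  obtain ⟨C₂, hC₂, h₂⟩ := exists_lintegral_large_cube_pdo_le hn hδ0 hδ1 ha
  refine ⟨C₁ + C₂ + 1, by positivity, fun f x => ?_⟩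
  have hle : ∀ {D : ℝ}, D ≤ C₁ + C₂ + 1 →
      ENNReal.ofReal D * mHL f x ≤ ENNReal.ofReal (C₁ + C₂ + 1) * mHL f x := fun hD => by
    gcongr
  refine iSup_le fun z => iSup_le fun l => iSup_le fun hl => iSup_le fun hx => ?_
  rcases le_total l 1 with hl1 | hl1
  · obtain ⟨c, hc⟩ := h₁ l z x f hl hl1 hx
    exact iInf_le_of_le c ((ENNReal.div_le_of_le_mul hc).trans (hle (by linarith)))
  · refine iInf_le_of_le 0 ((ENNReal.div_le_of_le_mul ?_).trans
      (hle (D := C₂) (by linarith)))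
    simp only [sub_zero]
    exact h₂ l z x f hl1 hx
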